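/- arXiv:1602.00476 — 5 statements merged into one kernel-verified Lean document; each statement's English description precedes it below -/
import Mathlib

section
/- For any two one-counter nets N=(Q,Act,δ) and N'=(Q',Act',δ'), there exist one-counter nets M with control-state set Q and M' with control-state set S ⊇ Q' such that the pair (M,M') is in normal form, and for all (q,n,q',n') ∈ Q×ℕ×Q'×ℕ and for each ⊑ ∈ {strong simulation preorder ⪯, weak simulation preorder ⪯w}: qn ⊑ q'n' with respect to N,N' if and only if qn ⊑ q'n' with respect to M,M'. -/
/-- A one-counter net over control states `Q` and actions `A`:
transitions carry a counter effect in `{-1, 0, 1}`. -/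
structure OCN (Q A : Type) where
  δ : Q → A → ℤ → Q → Prop
  effect_bounded : ∀ p a d q, δ p a d q → d = -1 ∨ d = 0 ∨ d = 1

namespace OCN

/-- The step relation of the LTS induced by a one-counter net on
configurations `Q × ℕ`:  `(p,m) →a (q,n)` iff there is a transition
`(p,a,d,q)` with `n = m + d ≥ 0`. -/
def Step {Q A : Type} (N : OCN Q A) (c : Q × ℕ) (a : A) (c' : Q × ℕ) : Prop :=
  ∃ d : ℤ, N.δ c.1 a d c'.1 ∧ (c'.2 : ℤ) = (c.2 : ℤ) + d

/-- An OCN is complete if every state has an `a`-labelled outgoing transition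
for every action `a`. -/
def Complete {Q A : Type} (N : OCN Q A) : Prop :=
  ∀ p a, ∃ d q, N.δ p a d q

/-- An OCN is non-blocking if every state has an outgoing transition with
counter effect in `{0, 1}`. -/
def NonBlocking {Q A : Type} (N : OCN Q A) : Prop :=
  ∀ p, ∃ a d q, N.δ p a d q ∧ (d = 0 ∨ d = 1)

end OCN

/-- `R` is a strong simulation between two labelled transition systems. -/
def IsSimulation {S S' A : Type} (stepL : S → A → S → Prop) (stepR : S' → A → S' → Prop)
    (R : S → S' → Prop) : Prop :=
  ∀ c c', R c c' → ∀ a d, stepL c a d → ∃ d', stepR c' a d' ∧ R d d'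

/-- The strong simulation preorder `⪯`: the largest strong simulation,
i.e. the union of all strong simulations. -/
def Simulates {S S' A : Type} (stepL : S → A → S → Prop) (stepR : S' → A → S' → Prop)
    (c : S) (c' : S') : Prop :=
  ∃ R, IsSimulation stepL stepR R ∧ R c c'

/-- Reachability via `τ`-labelled steps: `(→τ)*`. -/
def TauReach {S A : Type} (step : S → A → S → Prop) (τ : A) : S → S → Prop :=
  Relation.ReflTransGen (fun s t => step s τ t)

/-- Weak steps: `⇒τ = (→τ)*` and `⇒a = (→τ)* →a (→τ)*` for `a ≠ τ`. -/
def WeakStep {S A : Type} (step : S → A → S → Prop) (τ : A)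
    (s : S) (a : A) (t : S) : Prop :=
  (a = τ ∧ TauReach step τ s t) ∨
  (∃ u v, TauReach step τ s u ∧ step u a v ∧ TauReach step τ v t)

/-- `R` is a weak simulation: Spoiler moves along strong steps and
Duplicator responds with weak steps. -/
def IsWeakSimulation {S S' A : Type} (stepL : S → A → S → Prop)
    (stepR : S' → A → S' → Prop) (τ : A) (R : S → S' → Prop) : Prop :=
  ∀ c c', R c c' → ∀ a d, stepL c a d → ∃ d', WeakStep stepR τ c' a d' ∧ R d d'

/-- The weak simulation preorder `⪯w`: the largest weak simulation. -/
def WeakSimulates {S S' A : Type} (stepL : S → A → S → Prop)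
    (stepR : S' → A → S' → Prop) (τ : A) (c : S) (c' : S') : Prop :=
  ∃ R, IsWeakSimulation stepL stepR τ R ∧ R c c'

def nfL {Q A : Type} (N : OCN Q A) : OCN Q (Option A) where
  δ p a d q := match a with
    | some a => N.δ p a d q
    | none => d = 0 ∧ p = q
  effect_bounded := by
    intro p a d q h
    cases a with
    | none => exact Or.inr (Or.inl h.1)
    | some a => exact N.effect_bounded _ _ _ _ h

def nfRδ {Q A : Type} (N : OCN Q A) : Option Q → Option A → ℤ → Option Q → Prop
  | some p, some a, d, some q => N.δ p a d q
  | some p, none, d, some q => d = 0 ∧ p = q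
  | some _, some _, d, none => d = 0
  | some _, none, _, none => False
  | none, _, d, none => d = -1
  | none, _, _, some _ => False

def nfR {Q A : Type} (N : OCN Q A) : OCN (Option Q) (Option A) where
  δ := nfRδ N
  effect_bounded := by
    intro p a d q h
    rcases p with _ | p <;> rcases a with _ | a <;> rcases q with _ | q <;>
      simp only [nfRδ] at h
    all_goals first
      | exact N.effect_bounded _ _ _ _ h
      | omega

def nfE {Q : Type} (c : Q × ℕ) : Option Q × ℕ := (some c.1, c.2)

theorem nfL_some {Q A : Type} (N : OCN Q A) (c d : Q × ℕ) (a : A) :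
    (nfL N).Step c (some a) d ↔ N.Step c a d := Iff.rfl

theorem nfL_none {Q A : Type} (N : OCN Q A) (c d : Q × ℕ) :
    (nfL N).Step c none d ↔ d = c := by
  constructor
  · rintro ⟨k, ⟨rfl, h⟩, h2⟩
    exact Prod.ext h.symm (by omega)
  · rintro rfl
    exact ⟨0, ⟨rfl, rfl⟩, by simp⟩

theorem nfR_some {Q A : Type} (N : OCN Q A) (c d : Q × ℕ) (a : A) :
    (nfR N).Step (nfE c) (some a) (nfE d) ↔ N.Step c a d := Iff.rfl

theorem nfR_self {Q A : Type} (N : OCN Q A) (c : Q × ℕ) :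
    (nfR N).Step (nfE c) none (nfE c) := ⟨0, ⟨rfl, rfl⟩, by simp⟩

/-- Steps into embedded configurations come from embedded configurations. -/
theorem nfR_inv {Q A : Type} (N : OCN Q A) (s : Option Q × ℕ) (a : Option A) (d : Q × ℕ)
    (h : (nfR N).Step s a (nfE d)) : ∃ c, s = nfE c := by
  obtain ⟨p, m⟩ := s
  cases p with
  | none => obtain ⟨k, h, -⟩ := h; exact absurd h (by cases a <;> exact id)
  | some p => exact ⟨(p, m), rfl⟩

theorem nfR_sink {Q A : Type} (N : OCN Q A) (n : ℕ) (a : Option A) (t : Option Q × ℕ)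
    (h : (nfR N).Step (none, n) a t) : ∃ m, n = m + 1 ∧ t = (none, m) := by
  obtain ⟨k, h, h2⟩ := h
  obtain ⟨p, m⟩ := t
  cases p with
  | none =>
    have : k = -1 := by cases a <;> exact h
    exact ⟨m, by simp only at h2; omega, rfl⟩
  | some p => exact absurd h (by cases a <;> exact id)

theorem nfR_tau_sink {Q A : Type} (N : OCN Q A) (τ : Option A) (n : ℕ) (t : Option Q × ℕ)
    (h : TauReach (nfR N).Step τ (none, n) t) : ∃ m, m ≤ n ∧ t = (none, m) := by
  induction h with
  | refl => exact ⟨n, le_rfl, rfl⟩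
  | tail _ h ih =>
    obtain ⟨m, hm, rfl⟩ := ih
    obtain ⟨k, hk, rfl⟩ := nfR_sink N _ _ _ h
    exact ⟨k, by omega, rfl⟩

theorem nfR_tau_lift {Q A : Type} (N : OCN Q A) (τ : A) (c d : Q × ℕ)
    (h : TauReach N.Step τ c d) : TauReach (nfR N).Step (some τ) (nfE c) (nfE d) := by
  induction h with
  | refl => exact .refl
  | tail _ h ih => exact .tail ih h

theorem nfR_tau_inv {Q A : Type} (N : OCN Q A) (τ : A) (s : Option Q × ℕ) (d : Q × ℕ)
    (h : TauReach (nfR N).Step (some τ) s (nfE d)) :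
    ∃ c, s = nfE c ∧ TauReach N.Step τ c d := by
  induction h using Relation.ReflTransGen.head_induction_on with
  | refl => exact ⟨d, rfl, .refl⟩
  | head h _ ih =>
    obtain ⟨c, rfl, hc⟩ := ih
    obtain ⟨b, rfl⟩ := nfR_inv N _ _ _ h
    exact ⟨b, rfl, .head h hc⟩

theorem nfE_inj {Q : Type} {c d : Q × ℕ} (h : nfE c = nfE d) : c = d := by
  obtain ⟨a, b⟩ := c
  obtain ⟨a', b'⟩ := d
  simpa [nfE] using h

theorem nf_strong_sink {Q Q' A : Type} (N : OCN Q A) (N' : OCN Q' A)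
    (R : Q × ℕ → Option Q' × ℕ → Prop)
    (hR : IsSimulation (nfL N).Step (nfR N').Step R) (n : ℕ) (c : Q × ℕ) :
    ¬ R c (none, n) := by
  induction n using Nat.strong_induction_on with
  | _ n ih =>
    intro h
    obtain ⟨d, hd, hr⟩ := hR _ _ h none c ((nfL_none N c c).2 rfl)
    obtain ⟨m, hm, rfl⟩ := nfR_sink N' _ _ _ hd
    exact ih m (by omega) hr

theorem nf_weak_sink {Q Q' A : Type} (N : OCN Q A) (N' : OCN Q' A) (τ : A)
    (R : Q × ℕ → Option Q' × ℕ → Prop)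
    (hR : IsWeakSimulation (nfL N).Step (nfR N').Step (some τ) R) (n : ℕ) (c : Q × ℕ) :
    ¬ R c (none, n) := by
  induction n using Nat.strong_induction_on with
  | _ n ih =>
    intro h
    obtain ⟨d, hd, hr⟩ := hR _ _ h none c ((nfL_none N c c).2 rfl)
    rcases hd with ⟨h0, -⟩ | ⟨u, v, h1, h2, h3⟩
    · cases h0
    · obtain ⟨m, hm, rfl⟩ := nfR_tau_sink N' _ _ _ h1
      obtain ⟨k, hk, rfl⟩ := nfR_sink N' _ _ _ h2
      obtain ⟨l, hl, rfl⟩ := nfR_tau_sink N' _ _ _ h3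
      exact ih l (by omega) hr

theorem nf_strong {Q Q' A : Type} (N : OCN Q A) (N' : OCN Q' A) (c : Q × ℕ) (c' : Q' × ℕ) :
    Simulates N.Step N'.Step c c' ↔ Simulates (nfL N).Step (nfR N').Step c (nfE c') := by
  constructor
  · rintro ⟨R, hR, h⟩
    refine ⟨fun c s => ∃ c', s = nfE c' ∧ R c c', ?_, c', rfl, h⟩
    rintro c _ ⟨c', rfl, h⟩ a d hd
    cases a with
    | none =>
      obtain rfl := (nfL_none N _ _).1 hd
      exact ⟨_, nfR_self N' c', c', rfl, h⟩
    | some a =>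
      obtain ⟨d', h1, h2⟩ := hR _ _ h a d hd
      exact ⟨nfE d', h1, d', rfl, h2⟩
  · rintro ⟨R, hR, h⟩
    refine ⟨fun c c' => R c (nfE c'), ?_, h⟩
    intro c c' h a d hd
    obtain ⟨⟨p, m⟩, h1, h2⟩ := hR _ _ h (some a) d hd
    cases p with
    | none => exact absurd h2 (nf_strong_sink N N' R hR m d)
    | some p => exact ⟨(p, m), h1, h2⟩

theorem nf_weak {Q Q' A : Type} (N : OCN Q A) (N' : OCN Q' A) (τ : A)
    (c : Q × ℕ) (c' : Q' × ℕ) :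
    WeakSimulates N.Step N'.Step τ c c' ↔
      WeakSimulates (nfL N).Step (nfR N').Step (some τ) c (nfE c') := by
  constructor
  · rintro ⟨R, hR, h⟩
    refine ⟨fun c s => ∃ c', s = nfE c' ∧ R c c', ?_, c', rfl, h⟩
    rintro c _ ⟨c', rfl, h⟩ a d hd
    cases a with
    | none =>
      obtain rfl := (nfL_none N _ _).1 hd
      exact ⟨_, Or.inr ⟨_, _, .refl, nfR_self N' c', .refl⟩, c', rfl, h⟩
    | some a =>
      obtain ⟨d', h1, h2⟩ := hR _ _ h a d hd
      refine ⟨nfE d', ?_, d', rfl, h2⟩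
      rcases h1 with ⟨rfl, h1⟩ | ⟨u, v, h1, h3, h4⟩
      · exact Or.inl ⟨rfl, nfR_tau_lift _ _ _ _ h1⟩
      · exact Or.inr ⟨nfE u, nfE v, nfR_tau_lift _ _ _ _ h1, h3, nfR_tau_lift _ _ _ _ h4⟩
  · rintro ⟨R, hR, h⟩
    refine ⟨fun c c' => R c (nfE c'), ?_, h⟩
    intro c c' h a d hd
    obtain ⟨⟨p, m⟩, h1, h2⟩ := hR _ _ h (some a) d hd
    cases p with
    | none => exact absurd h2 (nf_weak_sink N N' τ R hR m d)
    | some p =>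
      refine ⟨(p, m), ?_, h2⟩
      rcases h1 with ⟨h0, h1⟩ | ⟨u, v, h1, h3, h4⟩
      · obtain ⟨b, hb, hr⟩ := nfR_tau_inv N' τ _ (p, m) h1
        obtain rfl := nfE_inj hb
        exact Or.inl ⟨Option.some.inj h0, hr⟩
      · obtain ⟨v, rfl, hv⟩ := nfR_tau_inv N' τ _ (p, m) h4
        obtain ⟨u, rfl⟩ := nfR_inv N' _ _ _ h3
        obtain ⟨b, hb, hr⟩ := nfR_tau_inv N' τ _ u h1
        obtain rfl := nfE_inj hb
        exact Or.inr ⟨u, v, hr, h3, hv⟩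

/-- **Normal form.** For any two OCNs `N`, `N'` (with a
distinguished internal action `τ`) there are OCNs `M` (with the same control
states `Q`, over a possibly extended action alphabet `B ⊇ A`) and `M'` (with
control states `S ⊇ Q'`) such that the pair `(M, M')` is in normal form
(`M` non-blocking and `M'` complete), and for all `(q,n,q',n')` and each of
strong and weak simulation preorder: `qn ⊑ q'n'` w.r.t. `N, N'` iff
`qn ⊑ q'n'` w.r.t. `M, M'`. -/
theorem normal_form_exists {Q Q' A : Type} [Fintype Q] [Fintype Q'] [Fintype A]
    (N : OCN Q A) (N' : OCN Q' A) (τ : A) :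
    ∃ (B : Type) (_ : Fintype B) (j : A → B) (S : Type) (_ : Fintype S)
      (ι : Q' → S) (M : OCN Q B) (M' : OCN S B),
      Function.Injective j ∧ Function.Injective ι ∧
      M.NonBlocking ∧ M'.Complete ∧
      ∀ (q : Q) (n : ℕ) (q' : Q') (n' : ℕ),
        (Simulates N.Step N'.Step (q, n) (q', n') ↔
          Simulates M.Step M'.Step (q, n) (ι q', n')) ∧
        (WeakSimulates N.Step N'.Step τ (q, n) (q', n') ↔
          WeakSimulates M.Step M'.Step (j τ) (q, n) (ι q', n')) := by
  refine ⟨Option A, inferInstance, some, Option Q', inferInstance, some, nfL N, nfR N',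
    Option.some_injective _, Option.some_injective _, ?_, ?_, ?_⟩
  · intro p
    exact ⟨none, 0, p, ⟨rfl, rfl⟩, Or.inl rfl⟩
  · intro p a
    rcases p with _ | p
    · exact ⟨-1, none, by cases a <;> rfl⟩
    · rcases a with _ | a
      · exact ⟨0, some p, rfl, rfl⟩
      · exact ⟨0, none, rfl⟩
  · intro q n q' n'
    exact ⟨nf_strong N N' (q, n) (q', n'), nf_weak N N' τ (q, n) (q', n')⟩
end

section
/- Belt Theorem: Let N and N' be two one-counter nets in normal form with control-state sets Q and Q' respectively, and let C ≤ |Q×Q'| be 1 plus the maximal length of an acyclic path in the product graph of N and N'. Then for every pair (q,q') ∈ Q×Q' there is a positive vector (ρ,ρ') ∈ ℕ² such that: (1) if (n,n') is C-above (ρ,ρ') then qn ⪯ q'n'; (2) if (n,n') is C-below (ρ,ρ') then qn ⋠ q'n'; and (3) ρ, ρ' ≤ C. -/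
/-- A vector `(ρ,ρ')` is positive if both components are nonnegative and it
is not the zero vector. -/
def PosVec (ρ ρ' : ℝ) : Prop := 0 ≤ ρ ∧ 0 ≤ ρ' ∧ ¬(ρ = 0 ∧ ρ' = 0)

/-- `(α,α')` is behind `(ρ,ρ')`: the clockwise angle from `(ρ,ρ')` to
`(α,α')` is strictly between 0° and 180°, equivalently the cross product
`ρ·α' − ρ'·α` is strictly negative. -/
def Behind (ρ ρ' α α' : ℝ) : Prop := ρ * α' - ρ' * α < 0

/-- The point `(n,n')` is `c`-above the vector `(ρ,ρ')`. -/
def CAbove (c ρ ρ' : ℝ) (n n' : ℤ) : Prop :=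
  ∃ r : ℝ, 0 < r ∧ (n : ℝ) < r * ρ - c ∧ r * ρ' + c < (n' : ℝ)

/-- The point `(n,n')` is `c`-below the vector `(ρ,ρ')`. -/
def CBelow (c ρ ρ' : ℝ) (n n' : ℤ) : Prop :=
  ∃ r : ℝ, 0 < r ∧ r * ρ + c < (n : ℝ) ∧ (n' : ℝ) < r * ρ' - c

/-- A step in the product graph of two OCNs: a common action label, the two
counter effects, and the target node. -/
abbrev PStep (Q Q' A : Type) := A × ℤ × ℤ × (Q × Q')

/-- Target node of a product-graph step. -/
def stepTgt {Q Q' A : Type} (s : PStep Q Q' A) : Q × Q' := s.2.2.2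

/-- End node of a path given by a source node and a list of steps. -/
def pathEnd {Q Q' A : Type} (v : Q × Q') : List (PStep Q Q' A) → Q × Q'
  | [] => v
  | s :: rest => pathEnd (stepTgt s) rest

/-- The list of nodes visited by a path. -/
def pathNodes {Q Q' A : Type} (v : Q × Q') (steps : List (PStep Q Q' A)) :
    List (Q × Q') :=
  v :: steps.map stepTgt

/-- Validity of a path in the product graph of `N` and `N'`: every step is a
pair of equally labelled transitions of the two nets. -/
def IsProdPath {Q Q' A : Type} (N : OCN Q A) (N' : OCN Q' A) :
    Q × Q' → List (PStep Q Q' A) → Prop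
  | _, [] => True
  | v, s :: rest =>
      N.δ v.1 s.1 s.2.1 (stepTgt s).1 ∧ N'.δ v.2 s.1 s.2.2.1 (stepTgt s).2 ∧
      IsProdPath N N' (stepTgt s) rest

/-- The set of numbers of the form (length of an acyclic path in the product
graph) + 1; its greatest element is the constant `C` of the Belt Theorem. -/
def AcyclicLenSet {Q Q' A : Type} (N : OCN Q A) (N' : OCN Q' A) : Set ℕ :=
  {k | ∃ v steps, IsProdPath N N' v steps ∧ (pathNodes v steps).Nodup ∧
        steps.length + 1 = k}

theorem game_lemma {V σ β : Type} [Finite V] (LS : V → σ → Prop) (LD : V → σ → β → Prop)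
    (tg : σ → β → V) (hne : ∀ v s, LS v s → ∃ r, LD v s r)
    (hfin : ∀ v s, {r | LD v s r}.Finite)
    (T : Set V) (w : σ → β → ℤ) (W : ℕ) (hW : ∀ v s r, LS v s → LD v s r → |w s r| ≤ W) :
    ∃ X : Set V, ∃ f g : V → ℤ, T ⊆ X ∧
      (∀ v ∈ X, v ∉ T → ∀ s, LS v s → ∃ r, LD v s r ∧ tg s r ∈ X ∧ f (tg s r) ≤ f v + w s r) ∧
      (∀ v, v ∉ X → ∃ s, LS v s ∧ ∀ r, LD v s r → tg s r ∉ X ∧ g v + w s r ≤ g (tg s r)) := by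
  classical
  let E : ℕ → V → ℤ → Prop := fun k => Nat.rec (fun _ c => 0 ≤ c)
    (fun _ ih v c => 0 ≤ c ∧ (v ∈ T ∨ ∀ s, LS v s → ∃ r, LD v s r ∧ ih (tg s r) (c + w s r))) k
  have E0 : ∀ v c, E 0 v c ↔ 0 ≤ c := fun v c => Iff.rfl
  have ES : ∀ k v c, E (k+1) v c ↔ 0 ≤ c ∧ (v ∈ T ∨ ∀ s, LS v s → ∃ r, LD v s r ∧ E k (tg s r) (c + w s r)) :=
    fun k v c => Iff.rfl
  clear_value E
  have Epos : ∀ k v c, E k v c → 0 ≤ c := by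
    intro k v c h
    cases k with
    | zero => exact (E0 v c).1 h
    | succ k => exact ((ES k v c).1 h).1
  have Emono : ∀ k v c c', c ≤ c' → E k v c → E k v c' := by
    intro k
    induction k with
    | zero => intro v c c' h h1; rw [E0] at *; omega
    | succ k ih =>
      intro v c c' h h1
      rw [ES] at *
      refine ⟨by omega, h1.2.imp id fun h2 s hs => ?_⟩
      obtain ⟨r, hr, hr2⟩ := h2 s hs
      exact ⟨r, hr, ih _ _ _ (by omega) hr2⟩
  have Eanti1 : ∀ k v c, E (k+1) v c → E k v c := by
    intro k
    induction k with
    | zero => intro v c h; rw [E0]; exact Epos _ _ _ h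
    | succ k ih =>
      intro v c h1
      rw [ES] at h1 ⊢
      refine ⟨h1.1, h1.2.imp id fun h2 s hs => ?_⟩
      obtain ⟨r, hr, hr2⟩ := h2 s hs
      exact ⟨r, hr, ih _ _ hr2⟩
  have Eanti : ∀ k k' v c, k ≤ k' → E k' v c → E k v c := by
    intro k k' v c h
    induction h with
    | refl => exact id
    | step _ ih => exact fun h => ih (Eanti1 _ _ _ h)
  have Etop : ∀ k v, E k v ((k * W : ℕ) : ℤ) := by
    intro k
    induction k with
    | zero => intro v; rw [E0]; positivity
    | succ k ih =>
      intro v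
      rw [ES]
      refine ⟨by positivity, Or.inr fun s hs => ?_⟩
      obtain ⟨r, hr⟩ := hne v s hs
      refine ⟨r, hr, Emono _ _ _ _ ?_ (ih _)⟩
      have := (abs_le.1 (hW v s r hs hr)).1
      push_cast
      linarith
  let X : Set V := {v | ∃ c : ℕ, ∀ k, E k v c}
  let f : V → ℤ := fun v => if h : ∃ c : ℕ, ∀ k, E k v c then (Nat.find h : ℤ) else 0
  have hf : ∀ v ∈ X, ∀ k, E k v (f v) := by
    intro v hv
    have hv' : ∃ c : ℕ, ∀ k, E k v c := hv
    simp only [f, dif_pos hv']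
    exact Nat.find_spec hv'
  have hfle : ∀ v, ∀ c : ℤ, (∀ k, E k v c) → v ∈ X ∧ f v ≤ c := by
    intro v c h
    have hc := Epos _ _ _ (h 0)
    lift c to ℕ using hc
    have hv' : ∃ c : ℕ, ∀ k, E k v c := ⟨c, h⟩
    refine ⟨hv', ?_⟩
    simp only [f, dif_pos hv']
    exact_mod_cast Nat.find_min' hv' h
  have hTX : T ⊆ X := by
    intro v hv
    refine ⟨0, fun k => ?_⟩
    cases k with
    | zero => rw [E0]; simp
    | succ k => rw [ES]; exact ⟨by simp, Or.inl hv⟩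
  -- bounds
  obtain ⟨M, hM⟩ : ∃ M : ℤ, ∀ v, f v ≤ M := by
    obtain ⟨M, hM⟩ := (Set.finite_range f).bddAbove
    exact ⟨M, fun v => hM ⟨v, rfl⟩⟩
  let M' : ℕ := (M + W).toNat
  have hM' : M + W ≤ M' := Int.self_le_toNat _
  obtain ⟨K, hK⟩ : ∃ K : ℕ, ∀ v, v ∉ X → ¬ E K v M' := by
    have h1 : ∀ v, ∃ k : ℕ, v ∉ X → ¬ E k v M' := by
      intro v
      by_cases hv : v ∈ X
      · exact ⟨0, fun h => absurd hv h⟩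
      · by_contra hcon
        push Not at hcon
        exact hv ⟨M', fun k => (hcon k).2⟩
    choose k hk using h1
    obtain ⟨K, hK⟩ := (Set.finite_range k).bddAbove
    exact ⟨K, fun v hv h => hk v hv (Eanti _ _ _ _ (hK ⟨v, rfl⟩) h)⟩
  have gex : ∀ k v, ∃ c : ℕ, E k v c := fun k v => ⟨_, Etop k v⟩
  let g : V → ℤ := fun v => (Nat.find (gex K v) : ℤ)
  refine ⟨X, f, g, hTX, ?_, ?_⟩
  · intro v hv hvT s hs
    have h1 : ∀ k, ∃ r, LD v s r ∧ E k (tg s r) (f v + w s r) := by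
      intro k
      have := (ES k v _).1 (hf v hv (k+1))
      exact (this.2.resolve_left hvT) s hs
    have h2 : ∃ r, LD v s r ∧ ∀ k, E k (tg s r) (f v + w s r) := by
      by_contra hcon
      push Not at hcon
      choose! k hk using hcon
      obtain ⟨B, hB⟩ := ((hfin v s).image k).bddAbove
      obtain ⟨r, hr, hr2⟩ := h1 B
      exact hk r hr (Eanti _ _ _ _ (hB ⟨r, hr, rfl⟩) hr2)
    obtain ⟨r, hr, h3⟩ := h2
    obtain ⟨h4, h5⟩ := hfle _ _ h3
    exact ⟨r, hr, h4, h5⟩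
  · intro v hv
    obtain ⟨h, hh⟩ : ∃ h, h = Nat.find (gex (K+1) v) := ⟨_, rfl⟩
    have hE : E (K+1) v h := hh ▸ Nat.find_spec (gex (K+1) v)
    have hmin : ∀ c : ℕ, c < h → ¬ E (K+1) v c := fun c hc => Nat.find_min (gex (K+1) v) (hh ▸ hc)
    have hgv : g v ≤ h := by
      simp only [g]
      exact_mod_cast Nat.find_min' (gex K v) (Eanti1 _ _ _ hE)
    have hbig : M' < h := by
      by_contra hcon
      push Not at hcon
      exact hK v hv (Emono _ _ _ _ (by exact_mod_cast hcon) (Eanti1 _ _ _ hE))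
    obtain ⟨m, rfl⟩ : ∃ m, h = m + 1 := ⟨h - 1, by omega⟩
    have hn := hmin m (by omega)
    rw [ES] at hn
    push Not at hn
    obtain ⟨_, s, hs, hr⟩ := hn (by positivity)
    refine ⟨s, hs, fun r hl => ?_⟩
    have hnr := hr r hl
    have hwb := (abs_le.1 (hW v s r hs hl)).1
    constructor
    · intro hx
      apply hnr
      refine Emono _ _ _ _ ?_ (hf _ hx K)
      have := hM (tg s r)
      omega
    · by_contra hcon
      push Not at hcon
      apply hnr
      refine Emono _ _ _ _ ?_ (Nat.find_spec (gex K (tg s r)))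
      simp only [g] at hcon hgv
      push_cast at *
      omega

section Paths
variable {Q Q' A : Type}

def GPath (G : Q × Q' → PStep Q Q' A → Prop) : Q × Q' → List (PStep Q Q' A) → Prop
  | _, [] => True
  | v, s :: rest => G v s ∧ GPath G (stepTgt s) rest

def Legal (N : OCN Q A) (N' : OCN Q' A) (v : Q × Q') (s : PStep Q Q' A) : Prop :=
  N.δ v.1 s.1 s.2.1 (stepTgt s).1 ∧ N'.δ v.2 s.1 s.2.2.1 (stepTgt s).2

def e1 (l : List (PStep Q Q' A)) : ℤ := (l.map (fun s => s.2.1)).sum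
def e2 (l : List (PStep Q Q' A)) : ℤ := (l.map (fun s => s.2.2.1)).sum

theorem e1_append (l l' : List (PStep Q Q' A)) : e1 (l ++ l') = e1 l + e1 l' := by simp [e1]
theorem e2_append (l l' : List (PStep Q Q' A)) : e2 (l ++ l') = e2 l + e2 l' := by simp [e2]
theorem e1_cons (s) (l' : List (PStep Q Q' A)) : e1 (s :: l') = s.2.1 + e1 l' := by simp [e1]
theorem e2_cons (s) (l' : List (PStep Q Q' A)) : e2 (s :: l') = s.2.2.1 + e2 l' := by simp [e2]

theorem GPath_append (G : Q × Q' → PStep Q Q' A → Prop) (v) (l l') :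
    GPath G v (l ++ l') ↔ GPath G v l ∧ GPath G (pathEnd v l) l' := by
  induction l generalizing v with
  | nil => simp [GPath, pathEnd]
  | cons s l ih => simp [GPath, pathEnd, ih, and_assoc]

theorem pathEnd_append (v : Q × Q') (l l' : List (PStep Q Q' A)) :
    pathEnd v (l ++ l') = pathEnd (pathEnd v l) l' := by
  induction l generalizing v with
  | nil => simp [pathEnd]
  | cons s l ih => simp [pathEnd, ih]

theorem GPath_prod {N : OCN Q A} {N' : OCN Q' A} {G : Q × Q' → PStep Q Q' A → Prop}
    (hG : ∀ v s, G v s → Legal N N' v s) (v) (l) (h : GPath G v l) : IsProdPath N N' v l := by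
  induction l generalizing v with
  | nil => trivial
  | cons s l ih => exact ⟨(hG _ _ h.1).1, (hG _ _ h.1).2, ih _ h.2⟩

theorem mem_split (u v : Q × Q') (l : List (PStep Q Q' A)) (h : u ∈ pathNodes v l) :
    ∃ l1 l2, l = l1 ++ l2 ∧ pathEnd v l1 = u := by
  induction l generalizing v with
  | nil => 
    simp [pathNodes] at h
    exact ⟨[], [], rfl, by simp [pathEnd, h]⟩
  | cons s l ih =>
    rw [pathNodes, List.mem_cons] at h
    rcases h with h | h
    · exact ⟨[], s :: l, rfl, by simp [pathEnd, h]⟩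
    · obtain ⟨l1, l2, h1, h2⟩ := ih (stepTgt s) (by simpa [pathNodes] using h)
      exact ⟨s :: l1, l2, by simp [h1], by simpa [pathEnd] using h2⟩

theorem nodes_append (v : Q × Q') (l l' : List (PStep Q Q' A)) :
    pathNodes v (l ++ l') = pathNodes v l ++ l'.map stepTgt := by simp [pathNodes]

theorem extend_path (G : Q × Q' → PStep Q Q' A → Prop) (v0) (l) (s) (h : GPath G v0 l)
    (hn : (pathNodes v0 l).Nodup) (hs : G (pathEnd v0 l) s) :
    (GPath G v0 (l ++ [s]) ∧ (pathNodes v0 (l ++ [s])).Nodup) ∨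
    ∃ l1 l2, l = l1 ++ l2 ∧ pathEnd v0 l1 = stepTgt s ∧ GPath G v0 l1 ∧ (pathNodes v0 l1).Nodup ∧
      GPath G (stepTgt s) (l2 ++ [s]) ∧ pathEnd (stepTgt s) (l2 ++ [s]) = stepTgt s := by
  by_cases hm : stepTgt s ∈ pathNodes v0 l
  · right
    obtain ⟨l1, l2, rfl, h2⟩ := mem_split _ _ _ hm
    rw [GPath_append] at h
    rw [nodes_append] at hn
    rw [pathEnd_append, h2] at hs
    rw [h2] at h
    refine ⟨l1, l2, rfl, h2, h.1, hn.of_append_left, ?_, ?_⟩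
    · rw [GPath_append]; exact ⟨h.2, hs, trivial⟩
    · rw [pathEnd_append]; rfl
  · left
    refine ⟨?_, ?_⟩
    · rw [GPath_append]; exact ⟨h, hs, trivial⟩
    · rw [nodes_append, List.map_singleton, List.nodup_append]
      refine ⟨hn, by simp, ?_⟩
      intro a ha b hb
      simp at hb
      rintro rfl
      exact hm (hb ▸ ha)

theorem eff_bound {N : OCN Q A} {N' : OCN Q' A} {G : Q × Q' → PStep Q Q' A → Prop}
    (hG : ∀ v s, G v s → Legal N N' v s) (v) (l) (h : GPath G v l) :
    -(l.length : ℤ) ≤ e1 l ∧ e1 l ≤ l.length ∧ -(l.length : ℤ) ≤ e2 l ∧ e2 l ≤ l.length := by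
  induction l generalizing v with
  | nil => simp [e1, e2]
  | cons s l ih =>
    have h1 := hG _ _ h.1
    have h2 := ih _ h.2
    have h3 := N.effect_bounded _ _ _ _ h1.1
    have h4 := N'.effect_bounded _ _ _ _ h1.2
    rw [e1_cons, e2_cons, List.length_cons]
    push_cast
    omega

theorem len_bound {N : OCN Q A} {N' : OCN Q' A} {G : Q × Q' → PStep Q Q' A → Prop}
    (hG : ∀ v s, G v s → Legal N N' v s) {C : ℕ} (hC : IsGreatest (AcyclicLenSet N N') C)
    (v) (l) (h : GPath G v l) (hn : (pathNodes v l).Nodup) : l.length + 1 ≤ C :=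
  hC.2 ⟨v, l, GPath_prod hG v l h, hn, rfl⟩

/-- perturbed weight -/
def wt (C : ℕ) (b : ℤ × ℤ) (s : PStep Q Q' A) : ℤ :=
  (C + 1) * (b.1 * s.2.2.1 - b.2 * s.2.1) + 1

theorem wt_sum (C : ℕ) (b : ℤ × ℤ) (l : List (PStep Q Q' A)) :
    (l.map (wt C b)).sum = (C + 1) * (b.1 * e2 l - b.2 * e1 l) + l.length := by
  induction l with
  | nil => simp [e1, e2]
  | cons s l ih =>
    rw [List.map_cons, List.sum_cons, ih, e1_cons, e2_cons, wt, List.length_cons]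
    push_cast; ring

end Paths

theorem sim_step {S S' A : Type} {sl : S → A → S → Prop} {sr : S' → A → S' → Prop} {c c'}
    (h : Simulates sl sr c c') {a d} (hd : sl c a d) : ∃ d', sr c' a d' ∧ Simulates sl sr d d' := by
  obtain ⟨R, hR, hc⟩ := h
  obtain ⟨d', h1, h2⟩ := hR _ _ hc a d hd
  exact ⟨d', h1, R, hR, h2⟩

theorem spoiler_step {Q Q' A : Type} (N : OCN Q A) (N' : OCN Q' A)
    (C : ℕ) (hC : IsGreatest (AcyclicLenSet N N') C) (b c : ℤ × ℤ)
    (hb1 : 0 ≤ b.1) (hb2 : 0 ≤ b.2) (hc1 : 0 ≤ c.1) (hc2 : 0 ≤ c.2)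
    (hadj : ∀ x y : ℤ, -C ≤ x → x ≤ C → -C ≤ y → y ≤ C → b.1 * y - b.2 * x < 0 →
      c.1 * y - c.2 * x ≤ 0)
    (X : Set (Q × Q')) (g : Q × Q' → ℤ)
    (hg : ∀ v, v ∉ X → ∃ a d p, N.δ v.1 a d p ∧ ∀ d' p', N'.δ v.2 a d' p' →
      (p, p') ∉ X ∧ g v + wt C b ((a, d, d', (p, p')) : PStep Q Q' A) ≤ g (p, p'))
    (hlow : ∀ q q' (n n' : ℕ), (q, q') ∉ X → b.1 * (n' + C) < b.2 * (n - C) →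
      ¬ Simulates N.Step N'.Step (q, n) (q', n')) :
    ∀ q q' (n n' : ℕ), (q, q') ∉ X → c.1 * (n' + C) < c.2 * (n - C) →
      ¬ Simulates N.Step N'.Step (q, n) (q', n') := by
  let G : Q × Q' → PStep Q Q' A → Prop := fun v s => Legal N N' v s ∧ g v + wt C b s ≤ g (stepTgt s)
  have hG : ∀ v s, G v s → Legal N N' v s := fun v s h => h.1
  have hpot : ∀ l v, GPath G v l → g v + (l.map (wt C b)).sum ≤ g (pathEnd v l) := by
    intro l
    induction l with
    | nil => intro v _; simp [pathEnd]
    | cons s l ih =>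
      intro v h
      have h1 := h.1.2
      have h2 := ih _ h.2
      rw [List.map_cons, List.sum_cons, pathEnd]
      omega
  have key : ∀ m k : ℕ, ∀ (v0) (l) (q) (q') (n n' : ℕ), GPath G v0 l → (pathNodes v0 l).Nodup →
      pathEnd v0 l = (q, q') → (q, q') ∉ X →
      c.1 * (n' - e2 l + C) < c.2 * (n - e1 l - C) →
      b.1 * (n' - e2 l) - b.2 * (n - e1 l) + 2 * C * (b.1 + b.2) < m →
      C ≤ l.length + k →
      ¬ Simulates N.Step N'.Step (q, n) (q', n') := by
    intro m
    induction m with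
    | zero =>
      intro k v0 l q q' n n' hp hn he hx hbel hm _
      have hl := len_bound hG hC _ _ hp hn
      obtain ⟨a1, a2, a3, a4⟩ := eff_bound hG _ _ hp
      apply hlow q q' n n' hx
      have u1 : b.1 * e2 l ≤ b.1 * C := mul_le_mul_of_nonneg_left (by omega) hb1
      have u2 : b.2 * (-e1 l) ≤ b.2 * C := mul_le_mul_of_nonneg_left (by omega) hb2
      push_cast at hm
      nlinarith
    | succ m ihm =>
      intro k
      induction k with
      | zero =>
        intro v0 l q q' n n' hp hn he hx hbel hm hk
        have hl := len_bound hG hC _ _ hp hn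
        omega
      | succ k ihk =>
        intro v0 l q q' n n' hp hn he hx hbel hm hk hsim
        have hl := len_bound hG hC _ _ hp hn
        obtain ⟨a1, a2, a3, a4⟩ := eff_bound hG _ _ hp
        obtain ⟨a, d, p, hd, hall⟩ := hg _ hx
        have hdb := N.effect_bounded _ _ _ _ hd
        have hn2 : 2 ≤ n := by
          by_contra hcon
          have h1 : (n : ℤ) - e1 l - C ≤ 0 := by omega
          have h2 : 0 ≤ (n' : ℤ) - e2 l + C := by omega
          have := mul_nonneg hc1 h2
          have := mul_nonneg hc2 (neg_nonneg.2 h1)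
          linarith
        have hstep : N.Step (q, n) a (p, ((n : ℤ) + d).toNat) := ⟨d, hd, by
          simp only; omega⟩
        obtain ⟨⟨p', n2'⟩, hstep', hsim'⟩ := sim_step hsim hstep
        obtain ⟨d', hd', hn2'⟩ := hstep'
        simp only at hd' hn2'
        obtain ⟨hx', hgp⟩ := hall d' p' hd'
        have hnn : ((((n : ℤ) + d).toNat : ℕ) : ℤ) = n + d := by omega
        have hGs : G (pathEnd v0 l) ((a, d, d', (p, p')) : PStep Q Q' A) := by
          rw [he]; exact ⟨⟨hd, hd'⟩, hgp⟩
        rcases extend_path G v0 l _ hp hn hGs with ⟨hp2, hnd2⟩ | ⟨l1, l2, hl12, h2, h3, h4, h5, h6⟩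
        · refine ihk v0 _ p p' _ n2' hp2 hnd2 ?_ hx' ?_ ?_ ?_ hsim'
          · rw [pathEnd_append]; rfl
          · rw [hnn, hn2', e1_append, e2_append]
            simp only [e1_cons, e2_cons]
            simp only [e1, e2, List.map_nil, List.sum_nil] at hbel ⊢
            ring_nf at hbel ⊢; exact hbel
          · rw [hnn, hn2', e1_append, e2_append]
            simp only [e1_cons, e2_cons]
            simp only [e1, e2, List.map_nil, List.sum_nil] at hm ⊢
            ring_nf at hm ⊢; exact hm
          · simp; omega
        · have hpt := hpot _ _ h5
          rw [h6, wt_sum] at hpt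
          obtain ⟨c1, c2, c3, c4⟩ := eff_bound hG _ _ h5
          have hlen : (l2 ++ [((a, d, d', (p, p')) : PStep Q Q' A)]).length ≤ C := by
            rw [hl12] at hl; simp at hl ⊢; omega
          have hlen1 : 1 ≤ (l2 ++ [((a, d, d', (p, p')) : PStep Q Q' A)]).length := by simp
          have ee1 : e1 (l2 ++ [((a, d, d', (p, p')) : PStep Q Q' A)]) = e1 l - e1 l1 + d := by
            rw [hl12, e1_append, e1_append, e1_cons]; simp [e1]
          have ee2 : e2 (l2 ++ [((a, d, d', (p, p')) : PStep Q Q' A)]) = e2 l - e2 l1 + d' := by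
            rw [hl12, e2_append, e2_append, e2_cons]; simp [e2]
          rw [ee1] at hpt c1 c2
          rw [ee2] at hpt c3 c4
          have hneg : b.1 * (e2 l - e2 l1 + d') - b.2 * (e1 l - e1 l1 + d) < 0 := by
            by_contra hcon
            push Not at hcon
            have : 0 ≤ ((C : ℤ) + 1) * (b.1 * (e2 l - e2 l1 + d') - b.2 * (e1 l - e1 l1 + d)) :=
              mul_nonneg (by positivity) hcon
            omega
          have hcn := hadj (e1 l - e1 l1 + d) (e2 l - e2 l1 + d') (by omega) (by omega) (by omega)
            (by omega) hneg
          refine ihm C v0 l1 p p' _ n2' h3 h4 h2 hx' ?_ ?_ (by omega) hsim'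
          · rw [hnn, hn2']; linarith
          · rw [hnn, hn2']; push_cast at hm; linarith
  intro q q' n n' hx hbel
  obtain ⟨m, hm⟩ : ∃ m : ℕ, b.1 * (n' : ℤ) - b.2 * n + 2 * C * (b.1 + b.2) < m :=
    ⟨(b.1 * (n' : ℤ) - b.2 * n + 2 * C * (b.1 + b.2)).toNat + 1, by push_cast; omega⟩
  refine key m C (q, q') [] q q' n n' trivial (by simp [pathNodes]) rfl hx ?_ ?_ (by simp)
  · simpa [e1, e2] using hbel
  · simpa [e1, e2] using hm

theorem above_mono {b c : ℤ × ℤ} (hb1 : 0 ≤ b.1) (hb2 : 0 ≤ b.2) (hc1 : 0 ≤ c.1) (hc2 : 0 ≤ c.2)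
    (hb : 0 < b.1 + b.2) (hbc : 0 ≤ b.1 * c.2 - b.2 * c.1) {x y : ℤ} (hx : 0 < x)
    (h : c.2 * x < c.1 * y) : b.2 * x < b.1 * y := by
  have hc : 0 < c.1 := by
    rcases hc1.lt_or_eq with h1 | h1
    · exact h1
    · rw [← h1] at h
      have := mul_nonneg hc2 hx.le
      linarith
  have hb1' : 0 < b.1 := by
    rcases hb1.lt_or_eq with h1 | h1
    · exact h1
    · rw [← h1] at hbc hb
      have := mul_pos (show 0 < b.2 by linarith) hc
      linarith
  have h1 : b.2 * c.1 * x ≤ b.1 * c.2 * x := mul_le_mul_of_nonneg_right (by linarith) hx.le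
  have h2 : b.1 * (c.2 * x) < b.1 * (c.1 * y) := mul_lt_mul_of_pos_left h hb1'
  have h3 : c.1 * (b.2 * x) < c.1 * (b.1 * y) := by linarith
  exact lt_of_mul_lt_mul_left h3 hc.le

theorem duplicator {Q Q' A : Type} (N : OCN Q A) (N' : OCN Q' A)
    (C : ℕ) (hC : IsGreatest (AcyclicLenSet N N') C) (b : ℕ → ℤ × ℤ)
    (hb1 : ∀ j, 0 ≤ (b j).1) (hb2 : ∀ j, 0 ≤ (b j).2) (hb : ∀ j, 0 < (b j).1 + (b j).2)
    (hmono : ∀ i j, i ≤ j → 0 ≤ (b i).1 * (b j).2 - (b i).2 * (b j).1)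
    (X : ℕ → Set (Q × Q')) (f : ℕ → Q × Q' → ℤ)
    (hf : ∀ j v, v ∈ X j → (∀ i < j, v ∉ X i) → ∀ a d p, N.δ v.1 a d p →
      ∃ d' p', N'.δ v.2 a d' p' ∧ (p, p') ∈ X j ∧
        f j (p, p') ≤ f j v + wt C (b j) ((a, d, d', (p, p')) : PStep Q Q' A)) :
    ∀ j q q' (n n' : ℕ), (q, q') ∈ X j → (b j).2 * (n + C) < (b j).1 * (n' - C) →
      Simulates N.Step N'.Step (q, n) (q', n') := by
  classical
  let lev : Q × Q' → ℕ := fun v => if h : ∃ j, v ∈ X j then Nat.find h else 0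
  have lev_spec : ∀ v, (∃ j, v ∈ X j) → v ∈ X (lev v) ∧ ∀ i < lev v, v ∉ X i := by
    intro v h
    simp only [lev, dif_pos h]
    exact ⟨Nat.find_spec h, fun i hi => Nat.find_min h hi⟩
  have lev_le : ∀ v j, v ∈ X j → lev v ≤ j := by
    intro v j h
    have h' : ∃ j, v ∈ X j := ⟨j, h⟩
    simp only [lev, dif_pos h']
    exact Nat.find_min' h' h
  clear_value lev
  let G : Q × Q' → PStep Q Q' A → Prop := fun v s => Legal N N' v s ∧ lev (stepTgt s) ≤ lev v ∧
    (lev (stepTgt s) = lev v → f (lev v) (stepTgt s) ≤ f (lev v) v + wt C (b (lev v)) s)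
  have hG : ∀ v s, G v s → Legal N N' v s := fun v s h => h.1
  have hpot : ∀ l v, GPath G v l → lev (pathEnd v l) ≤ lev v ∧ (lev (pathEnd v l) = lev v →
      f (lev v) (pathEnd v l) ≤ f (lev v) v + (l.map (wt C (b (lev v)))).sum) := by
    intro l
    induction l with
    | nil => intro v _; simp [pathEnd]
    | cons s l ih =>
      intro v h
      obtain ⟨h0, h1, h2⟩ := h.1
      obtain ⟨h3, h4⟩ := ih _ h.2
      rw [List.map_cons, List.sum_cons, pathEnd]
      refine ⟨by omega, fun he => ?_⟩
      have e1 : lev (stepTgt s) = lev v := by omega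
      have h5 := h2 e1
      have h6 := h4 (by omega)
      rw [e1] at h6
      omega
  intro j q q' n n' hx habv
  let R : Q × ℕ → Q' × ℕ → Prop := fun c c' => ∃ v0 l, GPath G v0 l ∧ (pathNodes v0 l).Nodup ∧
    pathEnd v0 l = (c.1, c'.1) ∧ (∃ i, (c.1, c'.1) ∈ X i) ∧
    (b (lev (c.1, c'.1))).2 * (c.2 - e1 l + C) < (b (lev (c.1, c'.1))).1 * (c'.2 - e2 l - C)
  refine ⟨R, ?_, ?_⟩
  · rintro ⟨q, n⟩ ⟨q', n'⟩ ⟨v0, l, hp, hn, he, hex, hab⟩ a ⟨p, n2⟩ ⟨d, hd, hn2⟩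
    simp only at he hex hab hd hn2
    have hl := len_bound hG hC _ _ hp hn
    obtain ⟨a1, a2, a3, a4⟩ := eff_bound hG _ _ hp
    obtain ⟨hin, hmin⟩ := lev_spec _ hex
    obtain ⟨d', p', hd', hin', hfl⟩ := hf _ _ hin hmin a d p hd
    have hdb := N.effect_bounded _ _ _ _ hd
    have hdb' := N'.effect_bounded _ _ _ _ hd'
    have hlev := lev_le _ _ hin'
    have hn' : 2 ≤ n' := by
      by_contra hcon
      have h1 : (n' : ℤ) - e2 l - C ≤ 0 := by omega
      have h2 : 0 ≤ (n : ℤ) - e1 l + C := by omega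
      have := mul_nonneg (hb2 (lev (q, q'))) h2
      have := mul_nonneg (hb1 (lev (q, q'))) (neg_nonneg.2 h1)
      linarith
    have hnn : ((((n' : ℤ) + d').toNat : ℕ) : ℤ) = n' + d' := by omega
    have hab2 : (b (lev (p, p'))).2 * (n - e1 l + C) < (b (lev (p, p'))).1 * (n' - e2 l - C) :=
      above_mono (hb1 _) (hb2 _) (hb1 _) (hb2 _) (hb _) (hmono _ _ hlev) (by omega) hab
    refine ⟨(p', ((n' : ℤ) + d').toNat), ⟨d', hd', hnn⟩, ?_⟩
    have hGs : G (pathEnd v0 l) ((a, d, d', (p, p')) : PStep Q Q' A) := by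
      rw [he]; exact ⟨⟨hd, hd'⟩, hlev, fun _ => hfl⟩
    rcases extend_path G v0 l _ hp hn hGs with ⟨hp2, hnd2⟩ | ⟨l1, l2, hl12, h2, h3, h4, h5, h6⟩
    · refine ⟨v0, _, hp2, hnd2, ?_, ⟨_, hin'⟩, ?_⟩
      · rw [pathEnd_append]; rfl
      · simp only
        rw [hnn, hn2, e1_append, e2_append]
        simp only [e1_cons, e2_cons]
        simp only [e1, e2, List.map_nil, List.sum_nil] at hab2 ⊢
        ring_nf at hab2 ⊢; exact hab2
    · refine ⟨v0, l1, h3, h4, h2, ⟨_, hin'⟩, ?_⟩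
      have hpt := (hpot _ _ h5).2 (by rw [h6])
      rw [h6, wt_sum] at hpt
      simp only [stepTgt] at hpt
      have hlen : (l2 ++ [((a, d, d', (p, p')) : PStep Q Q' A)]).length ≤ C := by
        rw [hl12] at hl; simp at hl ⊢; omega
      have ee1 : e1 (l2 ++ [((a, d, d', (p, p')) : PStep Q Q' A)]) = e1 l - e1 l1 + d := by
        rw [hl12, e1_append, e1_append, e1_cons]; simp [e1]
      have ee2 : e2 (l2 ++ [((a, d, d', (p, p')) : PStep Q Q' A)]) = e2 l - e2 l1 + d' := by
        rw [hl12, e2_append, e2_append, e2_cons]; simp [e2]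
      rw [ee1, ee2] at hpt
      have hneg : 0 ≤ (b (lev (p, p'))).1 * (e2 l - e2 l1 + d') -
          (b (lev (p, p'))).2 * (e1 l - e1 l1 + d) := by
        by_contra hcon
        push Not at hcon
        have : ((C : ℤ) + 1) * ((b (lev (p, p'))).1 * (e2 l - e2 l1 + d') -
          (b (lev (p, p'))).2 * (e1 l - e1 l1 + d)) ≤ (C + 1) * (-1) :=
          mul_le_mul_of_nonneg_left (by omega) (by positivity)
        omega
      simp only
      rw [hnn, hn2]
      linarith
  · refine ⟨(q, q'), [], trivial, by simp [pathNodes], rfl, ⟨j, hx⟩, ?_⟩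
    have hC1 : 1 ≤ C := by
      have := len_bound hG hC (q, q') [] trivial (by simp [pathNodes])
      omega
    have := above_mono (hb1 _) (hb2 _) (hb1 _) (hb2 _) (hb _) (hmono _ _ (lev_le _ _ hx))
      (by omega) habv
    simpa [e1, e2] using this

theorem slopes (C : ℕ) (hC : 1 ≤ C) : ∃ (m : ℕ) (b : ℕ → ℤ × ℤ),
    (∀ j, 0 ≤ (b j).1 ∧ 0 ≤ (b j).2 ∧ (b j).1 ≤ C ∧ (b j).2 ≤ C ∧ 0 < (b j).1 + (b j).2) ∧
    (b 0).2 = 0 ∧ (b m).1 = 0 ∧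
    (∀ i j, i ≤ j → 0 ≤ (b i).1 * (b j).2 - (b i).2 * (b j).1) ∧
    (∀ j, ∀ x y : ℤ, 0 ≤ x → x ≤ C → 0 ≤ y → y ≤ C → 0 < x + y →
      0 ≤ x * (b j).2 - y * (b j).1 ∨ 0 ≤ (b (j+1)).1 * y - (b (j+1)).2 * x) := by
  classical
  let key : ℤ × ℤ → ℚ := fun z => (z.2 : ℚ) / ((z.1 : ℚ) + z.2)
  let F : Finset (ℤ × ℤ) := ((Finset.Icc (0:ℤ) C) ×ˢ (Finset.Icc (0:ℤ) C)).filter (fun z => 0 < z.1 + z.2)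
  have hF : ∀ z : ℤ × ℤ, z ∈ F ↔ (0 ≤ z.1 ∧ 0 ≤ z.2 ∧ z.1 ≤ C ∧ z.2 ≤ C ∧ 0 < z.1 + z.2) := by
    intro z; simp only [F, Finset.mem_filter, Finset.mem_product, Finset.mem_Icc]; tauto
  have hkey : ∀ y z : ℤ × ℤ, y ∈ F → z ∈ F → (key y ≤ key z ↔ 0 ≤ y.1 * z.2 - y.2 * z.1) := by
    intro y z hy hz
    rw [hF] at hy hz
    have h1 : (0:ℚ) < (y.1 : ℚ) + y.2 := by exact_mod_cast hy.2.2.2.2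
    have h2 : (0:ℚ) < (z.1 : ℚ) + z.2 := by exact_mod_cast hz.2.2.2.2
    simp only [key]
    rw [div_le_div_iff₀ h1 h2]
    constructor
    · intro h
      have h' : y.2 * (z.1 + z.2) ≤ z.2 * (y.1 + y.2) := by exact_mod_cast h
      linarith
    · intro h
      have h' : y.2 * (z.1 + z.2) ≤ z.2 * (y.1 + y.2) := by linarith
      exact_mod_cast h'
  let K := F.image key
  have hKne : 0 < K.card := by
    rw [Finset.card_pos]
    exact ⟨key (1, 0), Finset.mem_image_of_mem _ ((hF _).2 (by simp; omega))⟩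
  let e := K.orderEmbOfFin rfl
  let ix : ℕ → Fin K.card := fun j => ⟨min j (K.card - 1), by omega⟩
  have hrep : ∀ j, ∃ z, z ∈ F ∧ key z = e (ix j) := by
    intro j
    have := K.orderEmbOfFin_mem rfl (ix j)
    exact Finset.mem_image.1 this
  choose b hbF hbk using hrep
  have hsurj : ∀ z ∈ F, ∃ i, key z = e i := by
    intro z hz
    have h1 : key z ∈ K := Finset.mem_image_of_mem _ hz
    have h2 : key z ∈ Set.range e := by
      simp only [e]
      rw [Finset.range_orderEmbOfFin]; exact h1
    obtain ⟨i, hi⟩ := h2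
    exact ⟨i, hi.symm⟩
  have hle : ∀ i j, key (b i) ≤ key (b j) ↔ ix i ≤ ix j := by
    intro i j; rw [hbk, hbk, e.le_iff_le]
  refine ⟨K.card, b, fun j => (hF _).1 (hbF j), ?_, ?_, ?_, ?_⟩
  · have h10 : ((1:ℤ), (0:ℤ)) ∈ F := (hF _).2 (by simp; omega)
    obtain ⟨i, hi⟩ := hsurj _ h10
    have h1 : key (b 0) ≤ key (1, 0) := by
      rw [hi, hbk, e.le_iff_le]; simp [ix, Fin.le_def]
    rw [hkey _ _ (hbF 0) h10] at h1
    have := (hF _).1 (hbF 0)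
    simp at h1
    omega
  · have h10 : ((0:ℤ), (1:ℤ)) ∈ F := (hF _).2 (by simp; omega)
    obtain ⟨i, hi⟩ := hsurj _ h10
    have h1 : key (0, 1) ≤ key (b K.card) := by
      rw [hi, hbk, e.le_iff_le]
      have := i.2
      simp only [ix, Fin.le_def]; omega
    rw [hkey _ _ h10 (hbF _)] at h1
    have := (hF _).1 (hbF K.card)
    simp at h1
    omega
  · intro i j hij
    rw [← hkey _ _ (hbF i) (hbF j), hle]
    simp only [ix, Fin.le_def]; omega
  · intro j x y hx hxC hy hyC hxy
    have hz : (x, y) ∈ F := (hF _).2 ⟨hx, hy, hxC, hyC, hxy⟩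
    have h1 := hkey _ _ hz (hbF j)
    have h2 := hkey _ _ (hbF (j+1)) hz
    simp only at h1 h2
    rw [← h1, ← h2]
    obtain ⟨i, hi⟩ := hsurj _ hz
    rw [hi, hbk, hbk, e.le_iff_le, e.le_iff_le]
    have := i.2
    simp only [ix, Fin.le_def]; omega

theorem adj_ext (C : ℕ) (b c : ℤ × ℤ) (hb1 : 0 ≤ b.1) (hb2 : 0 ≤ b.2) (hb : 0 < b.1 + b.2)
    (hc1 : 0 ≤ c.1) (hc2 : 0 ≤ c.2) (hbc : 0 ≤ b.1 * c.2 - b.2 * c.1)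
    (h : ∀ x y : ℤ, 0 ≤ x → x ≤ C → 0 ≤ y → y ≤ C → 0 < x + y →
      0 ≤ x * b.2 - y * b.1 ∨ 0 ≤ c.1 * y - c.2 * x) :
    ∀ x y : ℤ, -C ≤ x → x ≤ C → -C ≤ y → y ≤ C → b.1 * y - b.2 * x < 0 →
      c.1 * y - c.2 * x ≤ 0 := by
  intro x y hx1 hx2 hy1 hy2 hn
  rcases le_total 0 x with hx | hx <;> rcases le_total 0 y with hy | hy
  · rcases hb1.lt_or_eq with h1 | h1
    · have u1 : c.1 * (b.1 * y) ≤ c.1 * (b.2 * x) := mul_le_mul_of_nonneg_left (by linarith) hc1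
      have u2 : (b.2 * c.1) * x ≤ (b.1 * c.2) * x := mul_le_mul_of_nonneg_right (by linarith) hx
      have u3 : b.1 * (c.1 * y) ≤ b.1 * (c.2 * x) := by linarith
      have := le_of_mul_le_mul_left u3 h1
      linarith
    · rw [← h1] at hbc hb
      have hc0 : c.1 = 0 := by
        by_contra hne
        have := mul_pos (show 0 < b.2 by linarith) (lt_of_le_of_ne hc1 (Ne.symm hne))
        linarith
      rw [hc0]
      have := mul_nonneg hc2 hx
      linarith
  · have u1 := mul_nonneg hc1 (neg_nonneg.2 hy)
    have u2 := mul_nonneg hc2 hx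
    linarith
  · have u1 := mul_nonneg hb1 hy
    have u2 := mul_nonneg hb2 (neg_nonneg.2 hx)
    linarith
  · have hpos : 0 < -x + -y := by
      by_contra hcon
      have hx0 : x = 0 := by omega
      have hy0 : y = 0 := by omega
      subst hx0 hy0
      simp at hn
    rcases h (-x) (-y) (by omega) (by omega) (by omega) (by omega) hpos with h1 | h1
    · linarith
    · linarith

theorem above_int {C ρ ρ' n n' : ℕ} (hp : 0 < ρ + ρ')
    (h : CAbove (C : ℝ) (ρ : ℝ) (ρ' : ℝ) (n : ℤ) (n' : ℤ)) :
    (ρ' : ℤ) * (n + C) < ρ * (n' - C) := by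
  obtain ⟨r, hr, h1, h2⟩ := h
  have h3 : (ρ' : ℝ) * (n + C) < ρ * (n' - C) := by
    push_cast at h1 h2
    have u1 : (ρ' : ℝ) * (n + C) ≤ ρ' * (r * ρ) :=
      mul_le_mul_of_nonneg_left (by linarith) (by positivity)
    have u2 : (ρ : ℝ) * (r * ρ') ≤ ρ * (n' - C) :=
      mul_le_mul_of_nonneg_left (by linarith) (by positivity)
    rcases Nat.eq_zero_or_pos ρ with h0 | h0
    · have : (0:ℝ) < ρ' := by exact_mod_cast (by omega : 0 < ρ')
      have u3 : (ρ' : ℝ) * (n + C) < ρ' * (r * ρ) := mul_lt_mul_of_pos_left (by linarith) this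
      linarith
    · have : (0:ℝ) < ρ := by exact_mod_cast h0
      have u3 : (ρ : ℝ) * (r * ρ') < ρ * (n' - C) := mul_lt_mul_of_pos_left (by linarith) this
      linarith
  exact_mod_cast h3

theorem below_int {C ρ ρ' n n' : ℕ} (hp : 0 < ρ + ρ')
    (h : CBelow (C : ℝ) (ρ : ℝ) (ρ' : ℝ) (n : ℤ) (n' : ℤ)) :
    (ρ : ℤ) * (n' + C) < ρ' * (n - C) := by
  obtain ⟨r, hr, h1, h2⟩ := h
  exact above_int (by omega) ⟨r, hr, h2, h1⟩

/-- **Belt Theorem.** Let `N` and `N'` be two OCNs in normal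
form, and let `C` be 1 plus the maximal length of an acyclic path in their
product graph.  Then for every pair `(q, q')` of control states there is a
positive vector `(ρ, ρ') ∈ ℕ²` such that: (1) if `(n, n')` is `C`-above
`(ρ, ρ')` then `qn ⪯ q'n'`; (2) if `(n, n')` is `C`-below `(ρ, ρ')` then
`¬ (qn ⪯ q'n')`; and (3) `ρ, ρ' ≤ C`. -/
theorem belt_theorem {Q Q' A : Type} [Fintype Q] [Fintype Q'] [Fintype A]
    (N : OCN Q A) (N' : OCN Q' A)
    (hN : N.NonBlocking) (hN' : N'.Complete)
    (C : ℕ) (hC : IsGreatest (AcyclicLenSet N N') C)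
    (hCcard : C ≤ Fintype.card (Q × Q')) :
    ∀ (q : Q) (q' : Q'), ∃ ρ ρ' : ℕ,
      PosVec (ρ : ℝ) (ρ' : ℝ) ∧
      (∀ n n' : ℕ, CAbove (C : ℝ) (ρ : ℝ) (ρ' : ℝ) (n : ℤ) (n' : ℤ) →
        Simulates N.Step N'.Step (q, n) (q', n')) ∧
      (∀ n n' : ℕ, CBelow (C : ℝ) (ρ : ℝ) (ρ' : ℝ) (n : ℤ) (n' : ℤ) →
        ¬ Simulates N.Step N'.Step (q, n) (q', n')) ∧
      ρ ≤ C ∧ ρ' ≤ C := by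
  classical
  intro q q'
  have hC1 : 1 ≤ C := hC.2 ⟨(q, q'), [], trivial, by simp [pathNodes], rfl⟩
  obtain ⟨m, b, hb, hb0, hbm, hmono, hadj⟩ := slopes C hC1
  have hgame : ∀ (T : Set (Q × Q')) (b : ℤ × ℤ), ∃ X : Set (Q × Q'), ∃ f g : Q × Q' → ℤ, T ⊆ X ∧
      (∀ v ∈ X, v ∉ T → ∀ s : A × ℤ × Q, N.δ v.1 s.1 s.2.1 s.2.2 → ∃ r : ℤ × Q',
        N'.δ v.2 s.1 r.1 r.2 ∧ (s.2.2, r.2) ∈ X ∧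
        f (s.2.2, r.2) ≤ f v + wt C b ((s.1, s.2.1, r.1, (s.2.2, r.2)) : PStep Q Q' A)) ∧
      (∀ v, v ∉ X → ∃ s : A × ℤ × Q, N.δ v.1 s.1 s.2.1 s.2.2 ∧ ∀ r : ℤ × Q',
        N'.δ v.2 s.1 r.1 r.2 → (s.2.2, r.2) ∉ X ∧
        g v + wt C b ((s.1, s.2.1, r.1, (s.2.2, r.2)) : PStep Q Q' A) ≤ g (s.2.2, r.2)) := by
    intro T b
    refine game_lemma (V := Q × Q') (σ := A × ℤ × Q) (β := ℤ × Q')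
      (fun v s => N.δ v.1 s.1 s.2.1 s.2.2) (fun v s r => N'.δ v.2 s.1 r.1 r.2)
      (fun s r => (s.2.2, r.2)) ?_ ?_ T
      (fun s r => wt C b ((s.1, s.2.1, r.1, (s.2.2, r.2)) : PStep Q Q' A))
      ((C + 1) * (b.1.natAbs + b.2.natAbs) + 1) ?_
    · intro v s _
      obtain ⟨d, p, h⟩ := hN' v.2 s.1
      exact ⟨(d, p), h⟩
    · intro v s
      refine Set.Finite.subset ((Set.finite_Icc (-1 : ℤ) 1).prod (Set.finite_univ (α := Q'))) ?_
      intro r hr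
      have := N'.effect_bounded _ _ _ _ hr
      simp only [Set.mem_prod, Set.mem_Icc, Set.mem_univ, and_true]
      omega
    · intro v s r hs hr
      have h1 := N.effect_bounded _ _ _ _ hs
      have h2 := N'.effect_bounded _ _ _ _ hr
      have k1 : |s.2.1| ≤ 1 := by rw [abs_le]; omega
      have k2 : |r.1| ≤ 1 := by rw [abs_le]; omega
      simp only [wt]
      push_cast
      have u : |b.1 * r.1 - b.2 * s.2.1| ≤ |b.1| + |b.2| := by
        refine (abs_sub _ _).trans ?_
        rw [abs_mul, abs_mul]
        have := mul_le_mul_of_nonneg_left k1 (abs_nonneg b.2)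
        have := mul_le_mul_of_nonneg_left k2 (abs_nonneg b.1)
        linarith
      refine (abs_add_le _ _).trans ?_
      rw [abs_mul, abs_one, abs_of_nonneg (by positivity : (0:ℤ) ≤ (C:ℤ) + 1)]
      have := mul_le_mul_of_nonneg_left u (by positivity : (0:ℤ) ≤ (C:ℤ) + 1)
      linarith
  choose X f g hTX hD hS using hgame
  let T : ℕ → Set (Q × Q') := fun k => Nat.rec ∅ (fun j T => X T (b j)) k
  have T0 : T 0 = ∅ := rfl
  have TS : ∀ j, T (j+1) = X (T j) (b j) := fun j => rfl
  clear_value T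
  have Tmono : ∀ j, T j ⊆ T (j+1) := fun j => by rw [TS]; exact hTX _ _
  have spo : ∀ j, ∀ q q' (n n' : ℕ), (q, q') ∉ T j →
      (b j).1 * (n' + C) < (b j).2 * (n - C) → ¬ Simulates N.Step N'.Step (q, n) (q', n') := by
    intro j
    induction j with
    | zero =>
      intro q q' n n' _ h
      rw [hb0] at h
      have := mul_nonneg (hb 0).1 (by positivity : (0:ℤ) ≤ n' + C)
      linarith
    | succ j ih =>
      obtain ⟨p1, p2, p3, p4, p5⟩ := hb j
      obtain ⟨r1, r2, r3, r4, r5⟩ := hb (j+1)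
      refine spoiler_step N N' C hC (b j) (b (j+1)) p1 p2 r1 r2
        (adj_ext C _ _ p1 p2 p5 r1 r2 (hmono _ _ (by omega)) (hadj j)) (T (j+1)) (g (T j) (b j)) ?_ ?_
      · intro v hv
        rw [TS] at hv ⊢
        obtain ⟨s, hs, h⟩ := hS _ _ v hv
        exact ⟨s.1, s.2.1, s.2.2, hs, fun d' p' h' => h (d', p') h'⟩
      · intro q q' n n' hv
        exact ih q q' n n' (fun h => hv (Tmono j h))
  have dup := duplicator N N' C hC b (fun j => (hb j).1) (fun j => (hb j).2.1)
    (fun j => (hb j).2.2.2.2) hmono (fun j => T (j+1)) (fun j => f (T j) (b j)) (by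
      intro j v hv hmin a d p hd
      have hv' : v ∉ T j := by
        cases j with
        | zero => rw [T0]; exact id
        | succ i => exact hmin i (by omega)
      rw [TS] at hv ⊢
      obtain ⟨r, hr⟩ := hD _ _ v hv hv' (a, d, p) hd
      exact ⟨r.1, r.2, hr⟩)
  have hJ : ∃ J, J = m ∨ (q, q') ∈ T (J+1) := ⟨m, Or.inl rfl⟩
  obtain ⟨J, hJ1, hJ2⟩ : ∃ J, (J = m ∨ (q, q') ∈ T (J+1)) ∧ (q, q') ∉ T J := by
    refine ⟨Nat.find hJ, Nat.find_spec hJ, ?_⟩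
    rcases h : Nat.find hJ with _ | i
    · rw [T0]; exact id
    · exact fun hmem => Nat.find_min hJ (m := i) (by omega) (Or.inr hmem)
  obtain ⟨p1, p2, p3, p4, p5⟩ := hb J
  obtain ⟨ρ, hρ⟩ := Int.eq_ofNat_of_zero_le p1
  obtain ⟨ρ', hρ'⟩ := Int.eq_ofNat_of_zero_le p2
  have hpos : 0 < ρ + ρ' := by omega
  refine ⟨ρ, ρ', ⟨by positivity, by positivity, ?_⟩, ?_, ?_, by omega, by omega⟩
  · rintro ⟨h1, h2⟩
    have h1' : ρ = 0 := by exact_mod_cast h1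
    have h2' : ρ' = 0 := by exact_mod_cast h2
    omega
  · intro n n' h
    have h' := above_int hpos h
    rcases hJ1 with rfl | hJ1
    · rw [hbm] at hρ
      rw [← hρ] at h'
      have := mul_nonneg (by positivity : (0:ℤ) ≤ ρ') (by positivity : (0:ℤ) ≤ n + C)
      linarith
    · exact dup J q q' n n' hJ1 (by rw [hρ, hρ']; exact h')
  · intro n n' h
    have h' := below_int hpos h
    exact spo J q q' n n' hJ2 (by rw [hρ, hρ']; exact h')
end

section
/- A relation R ⊆ Q×ℕ×Q'×ℕ on the configurations of two one-counter nets is a strong simulation if for every (pm,p'm') ∈ R there exists (n,n') ∈ ℕ² such that the R-neighborhood of (m,m') equals the ⪯-neighborhood of (n,n'), where ⪯ is the strong simulation preorder. -/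
/-- The `R`-neighborhood of `(m, m')` agrees at argument `(q, q', l, l')`
with the `R'`-neighborhood of `(n, n')`: the `⊥`-pattern (whether the shifted
counters are nonnegative) is the same, and when both shifted points exist the
two relations agree on them. -/
def NHEq {Q Q' : Type} (R R' : Q × ℕ → Q' × ℕ → Prop) (m m' n n' : ℕ)
    (q : Q) (q' : Q') (l l' : ℤ) : Prop :=
  ((0 ≤ (m : ℤ) + l ∧ 0 ≤ (m' : ℤ) + l') ↔ (0 ≤ (n : ℤ) + l ∧ 0 ≤ (n' : ℤ) + l')) ∧
  (0 ≤ (m : ℤ) + l → 0 ≤ (m' : ℤ) + l' → 0 ≤ (n : ℤ) + l → 0 ≤ (n' : ℤ) + l' →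
    (R (q, ((m : ℤ) + l).toNat) (q', ((m' : ℤ) + l').toNat) ↔
     R' (q, ((n : ℤ) + l).toNat) (q', ((n' : ℤ) + l').toNat)))

/-- A relation `R` on the configurations of two one-counter
nets is a strong simulation if for every `(pm, p'm') ∈ R` there exists
`(n, n') ∈ ℕ²` such that the `R`-neighborhood of `(m, m')` equals the
`⪯`-neighborhood of `(n, n')`. -/
theorem locality_sim_condition {Q Q' A : Type} [Fintype Q] [Fintype Q'] [Fintype A]
    (N : OCN Q A) (N' : OCN Q' A) (R : Q × ℕ → Q' × ℕ → Prop)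
    (h : ∀ (p : Q) (m : ℕ) (p' : Q') (m' : ℕ), R (p, m) (p', m') →
      ∃ n n' : ℕ, ∀ (q : Q) (q' : Q') (l l' : ℤ),
        -1 ≤ l → l ≤ 1 → -1 ≤ l' → l' ≤ 1 →
        NHEq R (Simulates N.Step N'.Step) m m' n n' q q' l l') :
    IsSimulation N.Step N'.Step R := by
  rintro ⟨p, m⟩ ⟨p', m'⟩ hR a ⟨q, k⟩ ⟨d, hd, hk⟩
  obtain ⟨n, n', H⟩ := h p m p' m' hR
  simp only at hd hk
  have hb := N.effect_bounded _ _ _ _ hd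
  have h0 := (H p p' 0 0 (by omega) (by omega) (by omega) (by omega)).2
    (by omega) (by omega) (by omega) (by omega)
  simp only [add_zero, Int.toNat_natCast] at h0
  obtain ⟨S, hS, hSc⟩ := h0.1 hR
  have h1 := (H q p' d 0 (by omega) (by omega) (by omega) (by omega)).1.1
    ⟨by omega, by omega⟩
  obtain ⟨⟨q', k'⟩, ⟨e, he, hk'⟩, hSd⟩ := hS _ _ hSc a (q, ((n : ℤ) + d).toNat)
    ⟨d, hd, by simp only; omega⟩
  simp only at he hk'
  have hb' := N'.effect_bounded _ _ _ _ he
  have h2 := H q q' d e (by omega) (by omega) (by omega) (by omega)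
  have h3 := h2.1.2 ⟨by omega, by omega⟩
  have h4 := h2.2 h3.1 h3.2 (by omega) (by omega)
  have e1 : ((m : ℤ) + d).toNat = k := by omega
  have e2 : ((n' : ℤ) + e).toNat = k' := by omega
  rw [e1, e2] at h4
  refine ⟨(q', ((m' : ℤ) + e).toNat), ⟨e, he, ?_⟩, h4.2 ⟨S, hS, hSd⟩⟩
  have := h3.2
  simp only
  omega
end

section
/- For two one-counter nets N and N' with control-state sets Q and Q' respectively, there exist a one-counter net M with control-state set M ⊇ Q and an ω-net M' with control-state set M' ⊇ Q' such that for every pair (q,q') ∈ Q×Q' of original control states and all n,n' ∈ ℕ: qn ⪯w q'n' with respect to N,N' if and only if qn ⪯ q'n' with respect to M,M', where ⪯w is weak simulation preorder and ⪯ is strong simulation preorder. -/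
/-- An ω-net: transitions carry an effect in `{-1,0,1}` (encoded `some d`)
or the symbolic effect `ω` (encoded `none`). -/
structure OmegaNet (Q A : Type) where
  δ : Q → A → Option ℤ → Q → Prop
  effect_bounded : ∀ p a d q, δ p a (some d) q → d = -1 ∨ d = 0 ∨ d = 1

/-- Steps of the LTS induced by an ω-net: an ordinary transition changes the
counter by its effect; an `ω`-transition may increase it to any larger value. -/
def OmegaNet.Step {Q A : Type} (N : OmegaNet Q A) (c : Q × ℕ) (a : A) (c' : Q × ℕ) : Prop :=
  (∃ d : ℤ, N.δ c.1 a (some d) c'.1 ∧ (c'.2 : ℤ) = (c.2 : ℤ) + d) ∨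
  (N.δ c.1 a none c'.1 ∧ c.2 < c'.2)

namespace WSO

def effZ (o : Option SignType) : Option ℤ := Option.map (fun s : SignType => (s : ℤ)) o

def opStep (o : Option ℤ) (m k : ℕ) : Prop :=
  (∃ d : ℤ, o = some d ∧ (k : ℤ) = (m : ℤ) + d) ∨ (o = none ∧ m < k)

def Run : List (Option SignType) → ℕ → ℕ → Prop
  | [], m, n => m = n
  | o :: l, m, n => ∃ k, opStep (effZ o) m k ∧ Run l k n

lemma run_append (l₁ l₂ : List (Option SignType)) (m n : ℕ) :
    Run (l₁ ++ l₂) m n ↔ ∃ k, Run l₁ m k ∧ Run l₂ k n := by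
  induction l₁ generalizing m with
  | nil => simp [Run]
  | cons o l ih =>
    simp only [List.cons_append, Run, ih]
    constructor
    · rintro ⟨k, h, k', h1, h2⟩; exact ⟨k', ⟨k, h, h1⟩, h2⟩
    · rintro ⟨k', ⟨k, h, h1⟩, h2⟩; exact ⟨k, h, k', h1, h2⟩

lemma op_dec (m k : ℕ) : opStep (effZ (some (-1))) m k ↔ k + 1 = m := by
  simp [opStep, effZ]; omega

lemma op_inc (m k : ℕ) : opStep (effZ (some 1)) m k ↔ k = m + 1 := by
  simp [opStep, effZ]; omega

lemma op_zero (m k : ℕ) : opStep (effZ (some 0)) m k ↔ k = m := by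
  simp [opStep, effZ]

lemma op_om (m k : ℕ) : opStep (effZ none) m k ↔ m < k := by
  simp [opStep, effZ]

lemma run_dec (g m n : ℕ) : Run (List.replicate g (some (-1))) m n ↔ n + g = m := by
  induction g generalizing m with
  | zero => simp [Run]; omega
  | succ g ih =>
    simp only [List.replicate_succ, Run, ih, op_dec]
    constructor
    · rintro ⟨k, h, h'⟩; omega
    · intro h; exact ⟨n + g, by omega, rfl⟩

lemma run_inc (g m n : ℕ) : Run (List.replicate g (some 1)) m n ↔ n = m + g := by
  induction g generalizing m with
  | zero => simp [Run]; omega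
  | succ g ih =>
    simp only [List.replicate_succ, Run, ih, op_inc]
    constructor
    · rintro ⟨k, h, h'⟩; omega
    · intro h; exact ⟨m + 1, by omega, by omega⟩

lemma run_zero (g m n : ℕ) : Run (List.replicate g (some 0)) m n ↔ n = m := by
  induction g generalizing m with
  | zero => simp [Run]; omega
  | succ g ih =>
    simp only [List.replicate_succ, Run, ih, op_zero]
    constructor
    · rintro ⟨k, h, h'⟩; omega
    · intro h; exact ⟨m, by omega, by omega⟩

def Sound (W : ℕ → ℕ → Prop) (l : List (Option SignType)) : Prop :=
  ∀ m n, Run l m n → ∃ n', n ≤ n' ∧ W m n'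

lemma complete_fix (W : ℕ → ℕ → Prop) (hmono : ∀ m n k, W m n → W (m + k) (n + k))
    (m₀ E : ℕ) : ∃ T, ∀ m, m₀ ≤ m → W m (m + E - m₀) →
      ∃ l, l.length ≤ T ∧ Sound W l ∧ Run l m (m + E - m₀) := by
  classical
  by_cases h : ∃ g, m₀ ≤ g ∧ W g (g + E - m₀)
  · obtain ⟨hg1, hg2⟩ := Nat.find_spec h
    set g := Nat.find h with hg
    refine ⟨g + (g + E - m₀), fun m hm hW => ?_⟩
    have hgm : g ≤ m := Nat.find_min' h ⟨hm, hW⟩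
    refine ⟨List.replicate g (some (-1)) ++ List.replicate (g + E - m₀) (some 1), by simp, ?_, ?_⟩
    · intro m' n' hr
      rw [run_append] at hr
      obtain ⟨k, h1, h2⟩ := hr
      rw [run_dec] at h1
      rw [run_inc] at h2
      refine ⟨n', le_rfl, ?_⟩
      have := hmono _ _ k hg2
      convert this using 1 <;> omega
    · rw [run_append]
      refine ⟨m - g, (run_dec _ _ _).2 (by omega), (run_inc _ _ _).2 (by omega)⟩
  · exact ⟨0, fun m hm hW => (h ⟨m, hm, hW⟩).elim⟩

lemma complete_om (W : ℕ → ℕ → Prop) (hmono : ∀ m n k, W m n → W (m + k) (n + k)) :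
    ∃ T, ∀ m, (∀ B, ∃ n, B ≤ n ∧ W m n) →
      ∃ l, l.length ≤ T ∧ Sound W l ∧ ∀ n, ∃ n', n ≤ n' ∧ Run l m n' := by
  classical
  by_cases h : ∃ g, ∀ B, ∃ n, B ≤ n ∧ W g n
  · have hg2 := Nat.find_spec h
    set g := Nat.find h with hg
    refine ⟨g + 1, fun m hW => ?_⟩
    have hgm : g ≤ m := Nat.find_min' h hW
    refine ⟨List.replicate g (some (-1)) ++ [none], by simp, ?_, ?_⟩
    · intro m' n' hr
      rw [run_append] at hr
      obtain ⟨k, h1, h2⟩ := hr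
      rw [run_dec] at h1
      obtain ⟨n, hn, hw⟩ := hg2 n'
      refine ⟨n + k, by omega, ?_⟩
      have := hmono _ _ k hw
      convert this using 1; omega
    · intro n
      refine ⟨n + m + 1, by omega, ?_⟩
      rw [run_append]
      refine ⟨m - g, (run_dec _ _ _).2 (by omega), n + m + 1, (op_om _ _).2 (by omega), rfl⟩
  · exact ⟨0, fun m hW => (h ⟨m, hW⟩).elim⟩

lemma complete_W (W : ℕ → ℕ → Prop) (hmono : ∀ m n k, W m n → W (m + k) (n + k))
    (K : ℕ) (hK : ∀ m n, W m n → m + K ≤ n → ∀ B, ∃ n', B ≤ n' ∧ W m n') :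
    ∃ T, ∀ m n, W m n → ∃ l, l.length ≤ T ∧ Sound W l ∧ ∃ n', n ≤ n' ∧ Run l m n' := by
  classical
  by_cases h : ∃ m n, W m n
  · obtain ⟨n₀, hn₀⟩ := Nat.find_spec h
    have hmin : ∀ m n, W m n → Nat.find h ≤ m := fun m n hw => Nat.find_min' h ⟨n, hw⟩
    set m₀ := Nat.find h
    choose T hT using complete_fix W hmono m₀
    obtain ⟨T1, hT1⟩ := Finite.exists_le (fun i : Fin (m₀ + K) => T i)
    obtain ⟨T2, hT2⟩ := complete_om W hmono
    refine ⟨max T1 T2, fun m n hW => ?_⟩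
    have hm := hmin _ _ hW
    have hW2 : ∃ n', n ≤ n' ∧ n₀ + (m - m₀) ≤ n' ∧ W m n' := by
      rcases le_total n (n₀ + (m - m₀)) with h' | h'
      · refine ⟨_, h', le_rfl, ?_⟩
        have := hmono _ _ (m - m₀) hn₀
        convert this using 1; omega
      · exact ⟨n, le_rfl, h', hW⟩
    obtain ⟨n1, hn1, hn2, hw⟩ := hW2
    by_cases hb : m + K ≤ n1
    · obtain ⟨l, h1, h2, h3⟩ := hT2 m (hK _ _ hw hb)
      exact ⟨l, h1.trans (le_max_right _ _), h2, h3 n⟩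
    · have e : m + (n1 + m₀ - m) - m₀ = n1 := by omega
      obtain ⟨l, h1, h2, h3⟩ := hT (n1 + m₀ - m) m hm (by rw [e]; exact hw)
      rw [e] at h3
      have := hT1 ⟨n1 + m₀ - m, by omega⟩
      exact ⟨l, h1.trans (this.trans (le_max_left _ _)), h2, n1, hn1, h3⟩
  · exact ⟨0, fun m n hw => (h ⟨m, n, hw⟩).elim⟩

section
variable {Q A : Type} (N : OCN Q A) (τ : A)

lemma step_shift {c : Q × ℕ} {a : A} {d : Q × ℕ} (h : N.Step c a d) (k : ℕ) :
    N.Step (c.1, c.2 + k) a (d.1, d.2 + k) := by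
  obtain ⟨e, h1, h2⟩ := h
  exact ⟨e, h1, by push_cast; omega⟩

lemma step_le {c : Q × ℕ} {a : A} {d : Q × ℕ} (h : N.Step c a d) : d.2 ≤ c.2 + 1 := by
  obtain ⟨e, h1, h2⟩ := h
  have := N.effect_bounded _ _ _ _ h1
  omega

lemma tau_shift {c d : Q × ℕ} (h : TauReach N.Step τ c d) (k : ℕ) :
    TauReach N.Step τ (c.1, c.2 + k) (d.1, d.2 + k) := by
  induction h with
  | refl => exact .refl
  | tail _ h ih => exact ih.tail (step_shift N h k)

lemma tau_ivt {c d : Q × ℕ} (h : TauReach N.Step τ c d) (k : ℕ) (h1 : c.2 ≤ k) (h2 : k ≤ d.2) :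
    ∃ s, TauReach N.Step τ c (s, k) ∧ TauReach N.Step τ (s, k) d := by
  induction h with
  | refl =>
    obtain ⟨p, m⟩ := c
    obtain rfl : m = k := by simp at h1 h2; omega
    exact ⟨p, .refl, .refl⟩
  | @tail b d hb hs ih =>
    have := step_le N hs
    by_cases hk : k ≤ b.2
    · obtain ⟨s, h3, h4⟩ := ih hk
      exact ⟨s, h3, h4.tail hs⟩
    · obtain rfl : k = d.2 := by omega
      exact ⟨d.1, hb.tail hs, .refl⟩

lemma tau_chain (p : Q) (m j : ℕ) : ∀ q, TauReach N.Step τ (p, m) (q, m + j) →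
    ∃ s : ℕ → Q, s j = q ∧ TauReach N.Step τ (p, m) (s 0, m) ∧
      ∀ i k, i ≤ k → k ≤ j → TauReach N.Step τ (s i, m + i) (s k, m + k) := by
  classical
  induction j with
  | zero =>
    intro q h
    refine ⟨fun _ => q, rfl, h, fun i k h1 h2 => ?_⟩
    obtain rfl : k = 0 := by omega
    obtain rfl : i = 0 := by omega
    exact .refl
  | succ j ih =>
    intro q h
    obtain ⟨r, h1, h2⟩ := tau_ivt N τ h (m + j) (by simp) (by simp)
    obtain ⟨s, hs, h0, hc⟩ := ih r h1
    refine ⟨fun i => if i = j + 1 then q else s i, by simp, by simpa using h0, ?_⟩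
    intro i k hik hk
    by_cases hk' : k = j + 1
    · subst hk'
      by_cases hi : i = j + 1
      · subst hi; exact .refl
      · simp only [hi, if_false, if_true]
        have := hc i j (by omega) le_rfl
        rw [hs] at this
        exact Relation.ReflTransGen.trans this h2
    · have hi : i ≠ j + 1 := by omega
      simp only [hi, hk', if_false]
      exact hc i k hik (by omega)

lemma tau_iter (s : Q) (m e : ℕ) (h : TauReach N.Step τ (s, m) (s, m + e)) (t : ℕ) :
    TauReach N.Step τ (s, m) (s, m + t * e) := by
  induction t with
  | zero => simp; exact .refl
  | succ t ih =>
    have := tau_shift N τ h (t * e)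
    have h2 := Relation.ReflTransGen.trans ih this
    have e1 : m + (t + 1) * e = m + e + t * e := by ring
    rw [e1]
    exact h2

lemma tau_pump [Fintype Q] (p q : Q) (m n : ℕ) (h : TauReach N.Step τ (p, m) (q, n))
    (hn : m + Fintype.card Q ≤ n) (B : ℕ) : ∃ n', B ≤ n' ∧ TauReach N.Step τ (p, m) (q, n') := by
  obtain ⟨j, rfl⟩ : ∃ j, n = m + j := ⟨n - m, by omega⟩
  obtain ⟨s, hs, h0, hc⟩ := tau_chain N τ p m j q h
  have : ∃ i k, i < k ∧ k ≤ j ∧ s i = s k := by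
    obtain ⟨x, y, hxy, he⟩ := Fintype.exists_ne_map_eq_of_card_lt
      (fun i : Fin (j + 1) => s i) (by simp; omega)
    rcases lt_or_gt_of_ne hxy with h | h
    · exact ⟨x, y, h, by omega, he⟩
    · exact ⟨y, x, h, by omega, he.symm⟩
  obtain ⟨i, k, hik, hk, he⟩ := this
  have h1 := Relation.ReflTransGen.trans h0 (hc 0 i (by omega) (by omega))
  have h2 := hc i k hik.le hk
  have h3 := hc i j (by omega) le_rfl
  rw [hs] at h3
  obtain ⟨e, rfl⟩ : ∃ e, k = i + e := ⟨k - i, by omega⟩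
  rw [← he, ← add_assoc] at h2
  have h4 := tau_iter N τ _ _ _ h2 B
  have h5 := tau_shift N τ h3 (B * e)
  refine ⟨m + j + B * e, ?_, Relation.ReflTransGen.trans h1 (Relation.ReflTransGen.trans h4 h5)⟩
  have : 1 ≤ e := by omega
  nlinarith

lemma weak_shift {c : Q × ℕ} {a : A} {d : Q × ℕ} (h : WeakStep N.Step τ c a d) (k : ℕ) :
    WeakStep N.Step τ (c.1, c.2 + k) a (d.1, d.2 + k) := by
  rcases h with ⟨h1, h2⟩ | ⟨u, v, h1, h2, h3⟩
  · exact .inl ⟨h1, tau_shift N τ h2 k⟩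
  · exact .inr ⟨_, _, tau_shift N τ h1 k, step_shift N h2 k, tau_shift N τ h3 k⟩

lemma weak_pump [Fintype Q] (p q : Q) (a : A) (m n : ℕ) (h : WeakStep N.Step τ (p, m) a (q, n))
    (hn : m + (2 * Fintype.card Q + 1) ≤ n) (B : ℕ) :
    ∃ n', B ≤ n' ∧ WeakStep N.Step τ (p, m) a (q, n') := by
  rcases h with ⟨h1, h2⟩ | ⟨⟨u, k⟩, ⟨v, k'⟩, h1, h2, h3⟩
  · obtain ⟨n', h4, h5⟩ := tau_pump N τ p q m n h2 (by omega) B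
    exact ⟨n', h4, .inl ⟨h1, h5⟩⟩
  · have hle := step_le N h2
    simp only at hle
    by_cases hk : m + Fintype.card Q ≤ k
    · obtain ⟨n', h4, h5⟩ := tau_pump N τ p u m k h1 hk (k + B)
      obtain ⟨e, rfl⟩ : ∃ e, n' = k + e := ⟨n' - k, by omega⟩
      exact ⟨n + e, by omega, .inr ⟨_, _, h5, step_shift N h2 e, tau_shift N τ h3 e⟩⟩
    · obtain ⟨n', h4, h5⟩ := tau_pump N τ v q k' n h3 (by omega) B
      exact ⟨n', h4, .inr ⟨_, _, h1, h2, h5⟩⟩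

def WW (p : Q) (a : A) (q : Q) (m n : ℕ) : Prop := WeakStep N.Step τ (p, m) a (q, n)

lemma complete_all [Fintype Q] [Fintype A] : ∃ T, ∀ p a q m n, WW N τ p a q m n →
    ∃ l, l.length = T ∧ Sound (WW N τ p a q) l ∧ ∃ n', n ≤ n' ∧ Run l m n' := by
  have := fun x : Q × A × Q => complete_W (WW N τ x.1 x.2.1 x.2.2)
    (fun m n k h => weak_shift N τ h k) (2 * Fintype.card Q + 1)
    (fun m n h hn B => weak_pump N τ _ _ _ _ _ h hn B)
  choose T hT using this
  obtain ⟨T1, hT1⟩ := Finite.exists_le T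
  refine ⟨T1, fun p a q m n h => ?_⟩
  obtain ⟨l, h1, h2, n', h3, h4⟩ := hT (p, a, q) m n h
  have := hT1 (p, a, q)
  refine ⟨l ++ List.replicate (T1 - l.length) (some 0), by simp; omega, ?_, n', h3, ?_⟩
  · intro m n hr
    rw [run_append] at hr
    obtain ⟨k, h5, h6⟩ := hr
    rw [run_zero] at h6
    subst h6
    exact h2 _ _ h5
  · rw [run_append]
    exact ⟨n', h4, (run_zero _ _ _).2 rfl⟩

def netM (T : ℕ) : OCN (Q × Fin (T + 1)) (Option A) where
  δ p b d q := (∃ a, b = some a ∧ p.2.val = 0 ∧ q.2.val = T ∧ N.δ p.1 a d q.1) ∨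
    (b = none ∧ d = 0 ∧ p.1 = q.1 ∧ p.2.val = q.2.val + 1)
  effect_bounded := by
    rintro p b d q (⟨a, -, -, -, h⟩ | ⟨-, h, -⟩)
    · exact N.effect_bounded _ _ _ _ h
    · exact .inr (.inl h)

abbrev Ops (T : ℕ) := {l : List (Option SignType) // l.length ≤ T}

def netM' (T : ℕ) : OmegaNet (Q × Ops T) (Option A) where
  δ p b d q := (∃ a, b = some a ∧ d = some 0 ∧ p.2.val = [] ∧ q.2.val.length = T ∧
      Sound (WW N τ p.1 a q.1) q.2.val) ∨
    (b = none ∧ p.1 = q.1 ∧ ∃ o, d = effZ o ∧ p.2.val = o :: q.2.val)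
  effect_bounded := by
    rintro p b d q (⟨a, -, h, -⟩ | ⟨-, -, o, h, -⟩)
    · simp at h; omega
    · rcases o with _ | s
      · simp [effZ] at h
      · simp only [effZ, Option.map_some, Option.some.injEq] at h
        subst h
        cases s <;> simp
end

lemma omStep_op {Q A : Type} (M : OmegaNet Q A) (c : Q × ℕ) (a : A) (d : Q × ℕ) :
    M.Step c a d ↔ ∃ o, M.δ c.1 a o d.1 ∧ opStep o c.2 d.2 := by
  constructor
  · rintro (⟨e, h1, h2⟩ | ⟨h1, h2⟩)
    · exact ⟨_, h1, .inl ⟨e, rfl, h2⟩⟩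
    · exact ⟨_, h1, .inr ⟨rfl, h2⟩⟩
  · rintro ⟨o, h, ⟨e, rfl, h2⟩ | ⟨rfl, h2⟩⟩
    · exact .inl ⟨e, h, h2⟩
    · exact .inr ⟨h, h2⟩

lemma simulates_step {S S' A : Type} {stepL : S → A → S → Prop} {stepR : S' → A → S' → Prop}
    {c : S} {c' : S'} (h : Simulates stepL stepR c c') {a : A} {d : S} (hs : stepL c a d) :
    ∃ d', stepR c' a d' ∧ Simulates stepL stepR d d' := by
  obtain ⟨R, hR, h⟩ := h
  obtain ⟨d', h1, h2⟩ := hR _ _ h _ _ hs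
  exact ⟨d', h1, R, hR, h2⟩

section
variable {Q Q' A : Type} (N : OCN Q A) (N' : OCN Q' A) (τ : A) (T : ℕ)

lemma unwind (x : Q) (y : Q') (m : ℕ) : ∀ (i : ℕ) (hi : i < T + 1) (l : List (Option SignType))
    (hl : l.length ≤ T) (k : ℕ), l.length = i →
    Simulates (netM N T).Step (netM' N' τ T).Step ((x, ⟨i, hi⟩), m) ((y, ⟨l, hl⟩), k) →
    ∃ n, Run l k n ∧ Simulates (netM N T).Step (netM' N' τ T).Step
      ((x, 0), m) ((y, ⟨[], by simp⟩), n) := by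
  intro i
  induction i with
  | zero =>
    intro hi l hl k h0 hs
    obtain rfl := List.length_eq_zero_iff.1 h0
    exact ⟨k, rfl, hs⟩
  | succ i ih =>
    intro hi l hl k h0 hs
    have hst : (netM N T).Step ((x, ⟨i + 1, hi⟩), m) none ((x, ⟨i, by omega⟩), m) :=
      ⟨0, .inr ⟨rfl, rfl, rfl, rfl⟩, by simp⟩
    obtain ⟨⟨⟨y', l'⟩, k'⟩, h1, h2⟩ := simulates_step hs hst
    rw [omStep_op] at h1
    obtain ⟨o, (⟨a, h, -⟩ | ⟨-, h3, o', rfl, h4⟩), ho⟩ := h1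
    · simp at h
    · simp only at h3 h4 ho
      subst h3
      subst h4
      obtain ⟨n, h5, h6⟩ := ih (by omega) l'.1 l'.2 k' (by simpa using h0) h2
      exact ⟨n, ⟨k', ho, h5⟩, h6⟩

lemma strong_to_weak (q : Q) (q' : Q') (n n' : ℕ)
    (h : Simulates (netM N T).Step (netM' N' τ T).Step ((q, 0), n) ((q', ⟨[], by simp⟩), n')) :
    WeakSimulates N.Step N'.Step τ (q, n) (q', n') := by
  refine ⟨fun c c' => ∃ k ≤ c'.2, Simulates (netM N T).Step (netM' N' τ T).Step
    ((c.1, 0), c.2) ((c'.1, ⟨[], by simp⟩), k), ?_, n', le_rfl, h⟩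
  rintro ⟨x, m⟩ ⟨y, j⟩ ⟨k, hk, hs⟩ a ⟨x', m'⟩ ⟨e, h1, h2⟩
  have hst : (netM N T).Step ((x, 0), m) (some a) ((x', ⟨T, by omega⟩), m') :=
    ⟨e, .inl ⟨a, rfl, rfl, rfl, h1⟩, h2⟩
  obtain ⟨⟨⟨y', l'⟩, k'⟩, h3, h4⟩ := simulates_step hs hst
  rw [omStep_op] at h3
  obtain ⟨o, (⟨b, hb, rfl, -, hl, hS⟩ | ⟨hb, -⟩), ho⟩ := h3
  · simp only [Option.some.injEq] at hb hl hS ho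
    subst hb
    obtain rfl : k' = k := by simpa [opStep] using ho
    obtain ⟨n1, h5, h6⟩ := unwind N N' τ T x' y' m' T (by omega) l'.1 l'.2 k' hl h4
    obtain ⟨n2, h7, h8⟩ := hS _ _ h5
    have h9 := weak_shift N' τ h8 (j - k')
    refine ⟨(y', n2 + (j - k')), ?_, n1, ?_, h6⟩
    · convert h9 using 2; simp at hk ⊢; omega
    · simp; omega
  · simp at hb

lemma weak_to_strong (hT : ∀ p a q m n, WW N' τ p a q m n →
    ∃ l, l.length = T ∧ Sound (WW N' τ p a q) l ∧ ∃ n', n ≤ n' ∧ Run l m n')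
    (q : Q) (q' : Q') (n n' : ℕ) (h : WeakSimulates N.Step N'.Step τ (q, n) (q', n')) :
    Simulates (netM N T).Step (netM' N' τ T).Step ((q, 0), n) ((q', ⟨[], by simp⟩), n') := by
  obtain ⟨R, hR, h⟩ := h
  refine ⟨fun c c' => c'.1.2.1.length = c.1.2.1 ∧ ∃ k, Run c'.1.2.1 c'.2 k ∧ ∃ j ≤ k,
    R (c.1.1, c.2) (c'.1.1, j), ?_, rfl, n', rfl, n', le_rfl, h⟩
  rintro ⟨⟨x, i⟩, m⟩ ⟨⟨y, l⟩, r⟩ ⟨hl, k, hr, j, hj, hR'⟩ b ⟨⟨x', i'⟩, m'⟩ ⟨e, hδ, he⟩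
  rcases hδ with ⟨a, rfl, h1, h2, h3⟩ | ⟨rfl, rfl, h1, h2⟩
  · simp only at hl hr hR' h1 h2 h3 he
    have hl0 : l.1 = [] := List.length_eq_zero_iff.1 (by omega)
    rw [hl0] at hr
    obtain rfl : r = k := hr
    obtain ⟨⟨y', j'⟩, h4, h5⟩ := hR _ _ hR' a (x', m') ⟨e, h3, he⟩
    have h6 := weak_shift N' τ h4 (r - j)
    obtain ⟨l', h7, h8, n1, h9, h10⟩ := hT y a y' r (j' + (r - j)) (by
      unfold WW; convert h6 using 2; simp; omega)
    refine ⟨((y', ⟨l', h7.le⟩), r), ?_, ?_, n1, h10, j', by omega, h5⟩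
    · rw [omStep_op]
      exact ⟨some 0, .inl ⟨a, rfl, rfl, hl0, h7, h8⟩, .inl ⟨0, rfl, by simp⟩⟩
    · simp only; omega
  · simp only at hl hr hR' h1 h2 he
    subst h1
    obtain ⟨l, hlT⟩ := l
    rcases l with _ | ⟨o, l⟩
    · simp at hl; omega
    · obtain ⟨k1, h3, h4⟩ := hr
      refine ⟨((y, ⟨l, by simp at hlT; omega⟩), k1), ?_, ?_, k, h4, j, hj, ?_⟩
      · rw [omStep_op]
        exact ⟨effZ o, .inr ⟨rfl, rfl, o, rfl, rfl⟩, h3⟩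
      · simp at hl ⊢; omega
      · obtain rfl : m' = m := by omega
        exact hR'
end

end WSO

/-- For two OCNs `N`, `N'` (with internal action `τ`) there
exist a one-counter net `M` whose control states contain `Q` and an ω-net
`M'` whose control states contain `Q'` (over a possibly extended action
alphabet) such that for every pair `(q, q')` of original control states and
all `n, n' ∈ ℕ`:  `qn ⪯w q'n'` w.r.t. `N, N'` iff `qn ⪯ q'n'` w.r.t.
`M, M'`. -/
theorem weak_to_strong_omega {Q Q' A : Type} [Fintype Q] [Fintype Q'] [Fintype A]
    (N : OCN Q A) (N' : OCN Q' A) (τ : A) :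
    ∃ (B : Type) (_ : Fintype B) (SM SM' : Type) (_ : Fintype SM) (_ : Fintype SM')
      (ι : Q → SM) (ι' : Q' → SM')
      (M : OCN SM B) (M' : OmegaNet SM' B),
      Function.Injective ι ∧ Function.Injective ι' ∧
      ∀ (q : Q) (q' : Q') (n n' : ℕ),
        WeakSimulates N.Step N'.Step τ (q, n) (q', n') ↔
        Simulates M.Step M'.Step (ι q, n) (ι' q', n') := by
  classical
  obtain ⟨T, hT⟩ := WSO.complete_all N' τ
  have : Finite (WSO.Ops T) := (List.finite_length_le (Option SignType) T).to_subtype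
  refine ⟨Option A, inferInstance, Q × Fin (T + 1), Q' × WSO.Ops T, inferInstance,
    Fintype.ofFinite _, fun q => (q, 0), fun q => (q, ⟨[], by simp⟩), WSO.netM N T,
    WSO.netM' N' τ T, ?_, ?_, ?_⟩
  · intro a b h; exact congrArg Prod.fst h
  · intro a b h; exact congrArg Prod.fst h
  · intro q q' n n'
    exact ⟨WSO.weak_to_strong N N' τ T hT q q' n n', WSO.strong_to_weak N N' τ T q q' n n'⟩
end

section
/- Weak simulation approximants on one-counter nets converge at level ω² but not earlier in general: (1) for any two one-counter nets, the weak simulation approximant ⪯w_{ω²} equals the weak simulation preorder ⪯w; and (2) for every k ∈ ℕ there exist one-counter nets and configurations A, B_k0 such that A ⪯w_{ω·k} B_k0 but A ⋠w B_k0, so ⪯w_{ω·k} ≠ ⪯w. -/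
/-- The weak simulation approximants `⪯w_α`, defined by transfinite
recursion: `⪯w_0` is the full relation, `s ⪯w_{α+1} s'` iff every step of `s`
has a weak-step response with results related by `⪯w_α`, and at limits `⪯w_λ`
is the intersection of the earlier approximants.  (The uniform recursion
below satisfies exactly these defining equations.) -/
noncomputable def WeakSimApx {S S' A : Type} (stepL : S → A → S → Prop)
    (stepR : S' → A → S' → Prop) (τ : A) : Ordinal → S → S' → Prop :=
  WellFounded.fix Ordinal.lt_wf (C := fun _ => S → S' → Prop)
    (fun α ih c c' =>
      ∀ (α' : Ordinal) (h : α' < α), ∀ a d, stepL c a d →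
        ∃ d', WeakStep stepR τ c' a d' ∧ ih α' h d d')

section Helpers

universe u

theorem apx_iff {S S' A : Type} (stepL : S → A → S → Prop)
    (stepR : S' → A → S' → Prop) (τ : A) (α : Ordinal) (c : S) (c' : S') :
    WeakSimApx stepL stepR τ α c c' ↔
      ∀ α' < α, ∀ a d, stepL c a d →
        ∃ d', WeakStep stepR τ c' a d' ∧ WeakSimApx stepL stepR τ α' d d' := by
  unfold WeakSimApx
  rw [WellFounded.fix_eq]

theorem apx_anti {S S' A : Type} {stepL : S → A → S → Prop}
    {stepR : S' → A → S' → Prop} {τ : A} {α β : Ordinal} (h : β ≤ α) {c : S} {c' : S'}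
    (hc : WeakSimApx stepL stepR τ α c c') : WeakSimApx stepL stepR τ β c c' := by
  rw [apx_iff] at hc ⊢
  exact fun α' hα' => hc α' (hα'.trans_le h)

theorem apx_of_sim {S S' A : Type} {stepL : S → A → S → Prop}
    {stepR : S' → A → S' → Prop} {τ : A} {R : S → S' → Prop}
    (hR : IsWeakSimulation stepL stepR τ R) (α : Ordinal) :
    ∀ c c', R c c' → WeakSimApx stepL stepR τ α c c' := by
  induction α using WellFoundedLT.induction with
  | ind α ih =>
    intro c c' h
    rw [apx_iff]
    intro α' hα' a d hd
    obtain ⟨d', h1, h2⟩ := hR c c' h a d hd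
    exact ⟨d', h1, ih α' hα' _ _ h2⟩

theorem ocn_step_add {Q A : Type} (N : OCN Q A) {c d : Q × ℕ} {a : A} (k : ℕ)
    (h : N.Step c a d) : N.Step (c.1, c.2 + k) a (d.1, d.2 + k) := by
  obtain ⟨e, h1, h2⟩ := h
  refine ⟨e, h1, ?_⟩
  push_cast
  omega

theorem ocn_tau_add {Q A : Type} (N : OCN Q A) {τ : A} {c d : Q × ℕ} (k : ℕ)
    (h : TauReach N.Step τ c d) :
    TauReach N.Step τ (c.1, c.2 + k) (d.1, d.2 + k) := by
  induction h with
  | refl => exact Relation.ReflTransGen.refl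
  | tail _ h2 ih => exact Relation.ReflTransGen.tail ih (ocn_step_add N k h2)

theorem ocn_weak_add {Q A : Type} (N : OCN Q A) {τ a : A} {c d : Q × ℕ} (k : ℕ)
    (h : WeakStep N.Step τ c a d) :
    WeakStep N.Step τ (c.1, c.2 + k) a (d.1, d.2 + k) := by
  rcases h with ⟨h1, h2⟩ | ⟨u, v, h1, h2, h3⟩
  · exact Or.inl ⟨h1, ocn_tau_add N k h2⟩
  · exact Or.inr ⟨_, _, ocn_tau_add N k h1, ocn_step_add N k h2, ocn_tau_add N k h3⟩

theorem apx_mono {Q Q' A : Type} (N : OCN Q A) (N' : OCN Q' A) (τ : A) (α : Ordinal) :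
    ∀ (p : Q) (q : Q') (m n m' n' : ℕ), m' ≤ m → n ≤ n' →
      WeakSimApx N.Step N'.Step τ α (p, m) (q, n) →
      WeakSimApx N.Step N'.Step τ α (p, m') (q, n') := by
  induction α using WellFoundedLT.induction with
  | ind α ih =>
    intro p q m n m' n' hm hn h
    obtain ⟨x, rfl⟩ := Nat.exists_eq_add_of_le hm
    obtain ⟨y, rfl⟩ := Nat.exists_eq_add_of_le hn
    rw [apx_iff] at h ⊢
    rintro α' hα' a ⟨p2, m2⟩ hd
    obtain ⟨⟨q2, n2⟩, h1, h2⟩ := h α' hα' a _ (ocn_step_add N x hd)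
    exact ⟨_, ocn_weak_add N' y h1, ih α' hα' _ _ _ _ _ _ (by simp) (by simp) h2⟩

theorem lower_stab (W : ℕ → Set ℕ) (hanti : ∀ i j, i ≤ j → W j ⊆ W i)
    (hlow : ∀ i m m', m' ≤ m → m ∈ W i → m' ∈ W i) :
    ∃ K, ∀ k, K ≤ k → W k = W K := by
  classical
  by_cases hall : ∀ k, W k = Set.univ
  · exact ⟨0, fun k _ => by rw [hall, hall]⟩
  · push Not at hall
    obtain ⟨k0, hk0⟩ := hall
    obtain ⟨M, hM⟩ := (Set.ne_univ_iff_exists_notMem _).1 hk0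
    have hfin : ∀ k, k0 ≤ k → (W k).Finite := fun k hk =>
      (Set.finite_Iio M).subset (fun x hx => by
        by_contra hxM
        exact hM (hlow k0 x M (by simpa using hxM) (hanti _ _ hk hx)))
    obtain ⟨⟨K, hK⟩, hmin⟩ : ∃ K : {k // k0 ≤ k}, ∀ k : {k // k0 ≤ k},
        (W K).ncard ≤ (W k).ncard := by
      let f : {k // k0 ≤ k} → ℕ := fun k => (W k).ncard
      have : Nonempty {k // k0 ≤ k} := ⟨⟨k0, le_rfl⟩⟩
      exact ⟨Function.argmin f, fun k => Function.argmin_le f k⟩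
    refine ⟨K, fun k hk => ?_⟩
    exact Set.eq_of_subset_of_ncard_le (hanti _ _ hk) (hmin ⟨k, hK.trans hk⟩) (hfin K hK)

theorem lt_omega_mul_succ {α : Ordinal} {k : ℕ}
    (h : α < Ordinal.omega0.{u} * ((k + 1 : ℕ) : Ordinal)) :
    ∃ i : ℕ, α < Ordinal.omega0.{u} * (k : Ordinal) + i := by
  rw [Nat.cast_add, Nat.cast_one, mul_add, mul_one] at h
  rcases lt_or_ge α (Ordinal.omega0.{u} * (k : Ordinal)) with h1 | h1
  · exact ⟨0, by simpa using h1⟩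
  · obtain ⟨β, rfl⟩ := exists_add_of_le h1
    have h2 : β < Ordinal.omega0.{u} := lt_of_add_lt_add_left h
    obtain ⟨n, rfl⟩ := Ordinal.lt_omega0.1 h2
    exact ⟨n + 1, by
      rw [add_lt_add_iff_left]
      exact_mod_cast Nat.lt_succ_self n⟩

theorem omega_mul_add_lt (k i : ℕ) :
    Ordinal.omega0.{u} * (k : Ordinal) + i < Ordinal.omega0.{u} * ((k + 1 : ℕ) : Ordinal) := by
  rw [Nat.cast_add, Nat.cast_one, mul_add, mul_one, add_lt_add_iff_left]
  exact Ordinal.natCast_lt_omega0 i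

theorem apx_limit {S S' A : Type} {stepL : S → A → S → Prop}
    {stepR : S' → A → S' → Prop} {τ : A} {k : ℕ} {c : S} {c' : S'}
    (h : ∀ i : ℕ, WeakSimApx stepL stepR τ (Ordinal.omega0.{u} * (k : Ordinal) + i) c c') :
    WeakSimApx stepL stepR τ (Ordinal.omega0.{u} * ((k + 1 : ℕ) : Ordinal)) c c' := by
  rw [apx_iff]
  intro α' hα' a d hd
  obtain ⟨i, hi⟩ := lt_omega_mul_succ hα'
  exact (apx_iff _ _ _ _ _ _).1 (h i) α' hi a d hd

theorem apx_fix {Q Q' A : Type} [Fintype Q'] (N : OCN Q A) (N' : OCN Q' A) (τ : A) (k : ℕ)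
    (hk : ∀ p q m, (∃ n, WeakSimApx N.Step N'.Step τ (Ordinal.omega0.{u} * (k : Ordinal)) (p, m) (q, n)) →
      ∃ n, WeakSimApx N.Step N'.Step τ (Ordinal.omega0.{u} * ((k + 1 : ℕ) : Ordinal)) (p, m) (q, n)) :
    IsWeakSimulation N.Step N'.Step τ
      (WeakSimApx N.Step N'.Step τ (Ordinal.omega0.{u} * ((k + 1 : ℕ) : Ordinal))) := by
  rintro c c' h a ⟨p, m⟩ hd
  rw [apx_iff] at h
  have h' := fun i : ℕ => h _ (omega_mul_add_lt k i) a _ hd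
  choose f hf1 hf2 using h'
  obtain ⟨q', hq'⟩ := Finite.exists_infinite_fiber (fun i => (f i).1)
  have hinf : ((fun i => (f i).1) ⁻¹' {q'}).Infinite := Set.infinite_coe_iff.1 hq'
  by_cases hb : BddAbove {n' | WeakStep N'.Step τ c' a (q', n')}
  · have hne : {n' | WeakStep N'.Step τ c' a (q', n')}.Nonempty := by
      obtain ⟨i, hi⟩ := hinf.nonempty
      have hi : (f i).1 = q' := hi
      exact ⟨(f i).2, by simpa [← hi] using hf1 i⟩
    refine ⟨(q', sSup {n' | WeakStep N'.Step τ c' a (q', n')}), Nat.sSup_mem hne hb, ?_⟩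
    apply apx_limit
    intro i
    obtain ⟨j, hj, hij⟩ := hinf.exists_gt i
    have hj : (f j).1 = q' := hj
    refine apx_anti (α := Ordinal.omega0.{u} * (k : Ordinal) + j) ?_
      (apx_mono N N' τ _ p q' m (f j).2 m _ le_rfl ?_ ?_)
    · gcongr
    · apply le_csSup hb
      simpa [← hj] using hf1 j
    · simpa [← hj] using hf2 j
  · obtain ⟨i, hi⟩ := hinf.nonempty
    have hi : (f i).1 = q' := hi
    obtain ⟨n, hn⟩ := hk p q' m ⟨(f i).2, by
      have := hf2 i
      refine apx_anti (α := Ordinal.omega0.{u} * (k : Ordinal) + i) le_self_add ?_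
      simpa [← hi] using this⟩
    rw [not_bddAbove_iff] at hb
    obtain ⟨n', hn', hlt⟩ := hb n
    exact ⟨(q', n'), hn', apx_mono N N' τ _ _ _ _ _ _ _ le_rfl hlt.le hn⟩

theorem part_one {Q Q' A : Type} [Fintype Q] [Fintype Q'] (N : OCN Q A) (N' : OCN Q' A)
    (τ : A) (c : Q × ℕ) (c' : Q' × ℕ)
    (h : WeakSimApx N.Step N'.Step τ (Ordinal.omega0.{u} ^ (2 : ℕ)) c c') :
    WeakSimulates N.Step N'.Step τ c c' := by
  have hs : ∀ x : Q × Q', ∃ K : ℕ, ∀ k, K ≤ k →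
      {m | ∃ n, WeakSimApx N.Step N'.Step τ (Ordinal.omega0.{u} * (k : Ordinal)) (x.1, m) (x.2, n)} =
      {m | ∃ n, WeakSimApx N.Step N'.Step τ (Ordinal.omega0.{u} * (K : Ordinal)) (x.1, m) (x.2, n)} := by
    intro x
    apply lower_stab (fun k : ℕ => {m | ∃ n, WeakSimApx N.Step N'.Step τ
      (Ordinal.omega0.{u} * (k : Ordinal)) (x.1, m) (x.2, n)})
    · rintro i j hij m ⟨n, hn⟩
      exact ⟨n, apx_anti (by gcongr) hn⟩
    · rintro i m m' hm ⟨n, hn⟩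
      exact ⟨n, apx_mono N N' τ _ _ _ _ _ _ _ hm le_rfl hn⟩
  choose K hK using hs
  let k := Finset.univ.sup K
  have hle : ∀ x, K x ≤ k := fun x => Finset.le_sup (Finset.mem_univ x)
  refine ⟨_, apx_fix N N' τ k ?_, apx_anti ?_ h⟩
  · intro p q m hm
    have h1 := hK (p, q) k (hle _)
    have h2 := hK (p, q) (k + 1) ((hle _).trans (Nat.le_succ k))
    have h3 := h1.trans h2.symm
    have hm' : m ∈ {m | ∃ n, WeakSimApx N.Step N'.Step τ (Ordinal.omega0.{u} * (k : Ordinal))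
      ((p, q).1, m) ((p, q).2, n)} := hm
    rw [h3] at hm'
    exact hm'
  · rw [pow_two]
    gcongr
    exact (Ordinal.natCast_lt_omega0 _).le

/-- Spoiler: a single state with an `a`-loop. -/
def spNet : OCN Unit Bool where
  δ _ a d _ := a = true ∧ d = 0
  effect_bounded := by rintro _ _ _ _ ⟨_, h⟩; exact Or.inr (Or.inl h)

/-- Duplicator: even states count down, odd states pump. -/
def dupNet (K : ℕ) : OCN (Fin K) Bool where
  δ p a d q := (a = true ∧ d = -1 ∧ q = p ∧ p.1 % 2 = 0) ∨
    (a = false ∧ d = 1 ∧ q = p ∧ p.1 % 2 = 1) ∨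
    (a = false ∧ d = 0 ∧ p.1 = q.1 + 1)
  effect_bounded := by
    rintro _ _ _ _ (⟨_, h, _⟩ | ⟨_, h, _⟩ | ⟨_, h, _⟩) <;> simp [h]

theorem dup_tau {K : ℕ} {c d : Fin K × ℕ} (h : TauReach (dupNet K).Step false c d) :
    d.1.1 < c.1.1 ∨ (d.1.1 = c.1.1 ∧ (c.1.1 % 2 = 1 ∨ d.2 = c.2)) := by
  induction h with
  | refl => simp
  | tail _ h2 ih =>
    obtain ⟨e, h1 | h1 | h1, h3⟩ := h2
    · simp at h1
    · obtain ⟨_, h4, h5, h6⟩ := h1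
      rw [h5]
      omega
    · omega

theorem dup_weak {K : ℕ} {c d : Fin K × ℕ} (h : WeakStep (dupNet K).Step false c true d) :
    d.1.1 < c.1.1 ∨ (d.1.1 = c.1.1 ∧ d.2 + 1 = c.2) := by
  rcases h with ⟨h1, h2⟩ | ⟨u, v, h1, h2, h3⟩
  · simp at h1
  · have h1 := dup_tau h1
    have h3 := dup_tau h3
    obtain ⟨e, h4 | h4 | h4, h5⟩ := h2
    · obtain ⟨_, h4, h6, h7⟩ := h4
      have : v.1.1 = u.1.1 := by rw [h6]
      omega
    · simp at h4
    · simp at h4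

theorem dup_not_sim {K : ℕ} (R : Unit × ℕ → Fin K × ℕ → Prop)
    (hR : IsWeakSimulation spNet.Step (dupNet K).Step false R) :
    ∀ (j n : ℕ) (x : Unit × ℕ) (c : Fin K × ℕ), c.1.1 = j → c.2 = n → ¬ R x c := by
  intro j
  induction j using Nat.strong_induction_on with
  | _ j ihj =>
    intro n
    induction n using Nat.strong_induction_on with
    | _ n ihn =>
      intro x c h1 h2 hx
      obtain ⟨d, hd, hxd⟩ := hR x c hx true x ⟨0, ⟨rfl, rfl⟩, by simp⟩
      rcases dup_weak hd with h | ⟨h, h'⟩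
      · exact ihj d.1.1 (by omega) d.2 x d rfl rfl hxd
      · exact ihn d.2 (by omega) x d (by omega) rfl hxd

theorem dup_pump {K : ℕ} (p : Fin K) (hp : p.1 % 2 = 1) (n m : ℕ) :
    TauReach (dupNet K).Step false (p, n) (p, n + m) := by
  induction m with
  | zero => exact Relation.ReflTransGen.refl
  | succ m ih =>
    refine Relation.ReflTransGen.tail ih ⟨1, Or.inr (Or.inl ⟨rfl, rfl, rfl, hp⟩), ?_⟩
    push_cast
    ring

theorem dup_apx {K : ℕ} (α : Ordinal) : ∀ (i n : ℕ) (x : Unit × ℕ) (p : Fin K),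
    p.1 = 2 * i → α ≤ Ordinal.omega0.{u} * (i : Ordinal) + n →
    WeakSimApx spNet.Step (dupNet K).Step false α x (p, n) := by
  induction α using WellFoundedLT.induction with
  | ind α ih =>
    intro i n x p hp hα
    rw [apx_iff]
    rintro α' hα' a d ⟨e, ⟨rfl, _⟩, _⟩
    have hlt := hα'.trans_le hα
    rcases n with _ | n
    · rcases i with _ | i
      · simp at hlt
      · obtain ⟨m, hm⟩ := lt_omega_mul_succ (by simpa using hlt)
        have hpK := p.2
        refine ⟨(⟨2 * i, by omega⟩, m), Or.inr ⟨(⟨2 * i, by omega⟩, m + 1), _, ?_, ?_,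
          Relation.ReflTransGen.refl⟩, ih α' hα' i m d _ rfl hm.le⟩
        · have s1 : (dupNet K).Step (p, 0) false (⟨2 * i + 1, by omega⟩, 0) :=
            ⟨0, Or.inr (Or.inr ⟨rfl, rfl, by simp only; omega⟩), by simp⟩
          have s2 := dup_pump (⟨2 * i + 1, by omega⟩ : Fin K) (by simp only; omega) 0 (m + 1)
          have s3 : (dupNet K).Step (⟨2 * i + 1, by omega⟩, 0 + (m + 1)) false
            (⟨2 * i, by omega⟩, m + 1) :=
            ⟨0, Or.inr (Or.inr ⟨rfl, rfl, by simp⟩), by simp⟩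
          exact Relation.ReflTransGen.tail (Relation.ReflTransGen.head s1 s2) s3
        · exact ⟨-1, Or.inl ⟨rfl, rfl, rfl, by simp⟩, by simp⟩
    · refine ⟨(p, n), Or.inr ⟨(p, n + 1), (p, n), Relation.ReflTransGen.refl, ?_,
          Relation.ReflTransGen.refl⟩, ih α' hα' i n d p hp ?_⟩
      · exact ⟨-1, Or.inl ⟨rfl, rfl, rfl, by simp only; omega⟩, by simp⟩
      · rw [Nat.cast_add, Nat.cast_one, ← add_assoc] at hlt
        exact Order.lt_add_one_iff.1 hlt

end Helpers

/-- Weak simulation approximants on one-counter nets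
converge at level `ω²` but not earlier in general:
(1) for any two OCNs the approximant `⪯w_{ω²}` equals the weak simulation
preorder `⪯w`; and
(2) for every `k ∈ ℕ` there exist OCNs and configurations `c, c'` with
`c ⪯w_{ω·k} c'` but not `c ⪯w c'`, so `⪯w_{ω·k} ≠ ⪯w`. -/
theorem weak_approximants_omega_squared :
    (∀ (Q Q' A : Type) (_ : Fintype Q) (_ : Fintype Q') (_ : Fintype A)
      (N : OCN Q A) (N' : OCN Q' A) (τ : A) (c : Q × ℕ) (c' : Q' × ℕ),
      WeakSimApx N.Step N'.Step τ (Ordinal.omega0 ^ (2 : ℕ)) c c' ↔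
        WeakSimulates N.Step N'.Step τ c c') ∧
    (∀ k : ℕ, ∃ (Q Q' A : Type) (_ : Fintype Q) (_ : Fintype Q') (_ : Fintype A)
      (N : OCN Q A) (N' : OCN Q' A) (τ : A) (c : Q × ℕ) (c' : Q' × ℕ),
      c'.2 = 0 ∧
      WeakSimApx N.Step N'.Step τ (Ordinal.omega0 * (k : Ordinal)) c c' ∧
      ¬ WeakSimulates N.Step N'.Step τ c c') := by
  refine ⟨?_, ?_⟩
  · intro Q Q' A _ _ _ N N' τ c c'
    exact ⟨part_one N N' τ c c', fun ⟨R, hR, h⟩ => apx_of_sim hR _ c c' h⟩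
  · intro k
    refine ⟨Unit, Fin (2 * k + 1), Bool, inferInstance, inferInstance, inferInstance,
      spNet, dupNet (2 * k + 1), false, ((), 0), (⟨2 * k, by omega⟩, 0), rfl, ?_, ?_⟩
    · exact dup_apx _ k 0 _ _ rfl (by simp)
    · rintro ⟨R, hR, h⟩
      exact dup_not_sim R hR _ _ _ _ rfl rfl h
end
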